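/- arXiv:0802.2897 — 7 statements merged into one kernel-verified Lean document; each statement's English description precedes it below -/
import Mathlib

section
/- Let R be a nonzero differential ring that contains a field of characteristic zero (equivalently, R is a ℚ-algebra). If R is differentially simple, then R is an integral domain. -/
/-- The ideal of elements annihilated by some power of `a`. -/
def powerTorsion {R : Type*} [CommRing R] (a : R) : Ideal R where
  carrier := {b | ∃ n : ℕ, a ^ n * b = 0}
  zero_mem' := ⟨0, by simp⟩
  add_mem' := by
    rintro x y ⟨m, hm⟩ ⟨n, hn⟩
    refine ⟨m + n, ?_⟩
    linear_combination a ^ n * hm + a ^ m * hn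
  smul_mem' := by
    rintro c x ⟨n, hn⟩
    refine ⟨n, ?_⟩
    rw [smul_eq_mul]
    linear_combination c * hn

theorem deriv_mem_powerTorsion {R : Type*} [CommRing R] (dR : Derivation ℤ R R) {a b : R}
    (hb : b ∈ powerTorsion a) : dR b ∈ powerTorsion a := by
  obtain ⟨n, hn⟩ := hb
  refine ⟨n + 1, ?_⟩
  have h := congrArg dR hn
  cases n with
  | zero =>
    obtain rfl : b = 0 := by simpa using hn
    simp
  | succ k =>
    rw [Derivation.leibniz, Derivation.leibniz_pow, map_zero] at h
    simp only [smul_eq_mul, nsmul_eq_mul, Nat.add_sub_cancel] at h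
    linear_combination a * h - ((k + 1 : ℕ) : R) * dR a * hn

/-- In a differentially simple ring, a zero divisor is nilpotent. -/
theorem eq_zero_of_mul_eq_zero_of_not_isNilpotent {R : Type*} [CommRing R]
    (dR : Derivation ℤ R R)
    (hsimple : ∀ I : Ideal R, (∀ x ∈ I, dR x ∈ I) → I = ⊥ ∨ I = ⊤)
    {a b : R} (ha : ¬ IsNilpotent a) (hab : a * b = 0) : b = 0 := by
  have hb : b ∈ powerTorsion a := ⟨1, by simpa using hab⟩
  rcases hsimple (powerTorsion a) (fun _ hx => deriv_mem_powerTorsion dR hx) with h | h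
  · simpa [h] using hb
  · obtain ⟨n, hn⟩ := (Ideal.eq_top_iff_one _).1 h
    exact absurd ⟨n, by simpa using hn⟩ ha

theorem isNilpotent_deriv {R : Type*} [CommRing R] [Nontrivial R] [Algebra ℚ R]
    (dR : Derivation ℤ R R)
    (hsimple : ∀ I : Ideal R, (∀ x ∈ I, dR x ∈ I) → I = ⊥ ∨ I = ⊤)
    {a : R} (ha : IsNilpotent a) : IsNilpotent (dR a) := by
  by_contra hd
  obtain ⟨n, hn⟩ := ha
  induction n with
  | zero => simp at hn
  | succ k ih =>
    apply ih
    have h := congrArg dR hn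
    rw [Derivation.leibniz_pow, map_zero] at h
    simp only [smul_eq_mul, nsmul_eq_mul, Nat.add_sub_cancel] at h
    have hu : IsUnit ((k + 1 : ℕ) : R) := by
      have := (IsUnit.mk0 ((k + 1 : ℕ) : ℚ) (by positivity)).map (algebraMap ℚ R)
      rwa [map_natCast] at this
    rw [hu.mul_right_eq_zero, mul_comm] at h
    exact eq_zero_of_mul_eq_zero_of_not_isNilpotent dR hsimple hd h

/-- A nonzero differentially simple differential ring containing a field of
characteristic zero (equivalently, a `ℚ`-algebra) is an integral domain. -/
theorem diffSimple_isDomain (R : Type*) [CommRing R] [Nontrivial R] [Algebra ℚ R]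
    (dR : Derivation ℤ R R)
    (hsimple : ∀ I : Ideal R, (∀ x ∈ I, dR x ∈ I) → I = ⊥ ∨ I = ⊤) :
    IsDomain R := by
  have hnil : nilradical R = ⊥ := by
    refine (hsimple (nilradical R) fun x hx => ?_).resolve_right fun h => ?_
    · exact mem_nilradical.2 (isNilpotent_deriv dR hsimple (mem_nilradical.1 hx))
    · exact not_isNilpotent_one (mem_nilradical.1 ((Ideal.eq_top_iff_one _).1 h))
  have : NoZeroDivisors R := by
    refine ⟨fun {a b} hab => or_iff_not_imp_left.2 fun ha => ?_⟩
    refine eq_zero_of_mul_eq_zero_of_not_isNilpotent dR hsimple (fun h => ha ?_) hab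
    simpa [hnil] using mem_nilradical.2 h
  exact NoZeroDivisors.to_isDomain R
end

section
/- Let R be a nonzero differential ring. If R is differentially simple, then every zero divisor of R is nilpotent. -/
/-- The ideal of elements annihilated by some power of `x`. -/
def powTorsionIdeal {R : Type*} [CommRing R] (x : R) : Ideal R where
  carrier := {y | ∃ n : ℕ, x ^ n * y = 0}
  zero_mem' := ⟨0, mul_zero _⟩
  add_mem' := by
    rintro a b ⟨m, hm⟩ ⟨n, hn⟩
    refine ⟨m + n, ?_⟩
    rw [pow_add]
    linear_combination x ^ n * hm + x ^ m * hn
  smul_mem' := by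
    rintro c a ⟨n, hn⟩
    refine ⟨n, ?_⟩
    rw [smul_eq_mul]
    linear_combination c * hn

theorem mem_powTorsionIdeal {R : Type*} [CommRing R] {x y : R} :
    y ∈ powTorsionIdeal x ↔ ∃ n : ℕ, x ^ n * y = 0 :=
  Iff.rfl

theorem Derivation.apply_mem_powTorsionIdeal {R : Type*} [CommRing R] (d : Derivation ℤ R R)
    {x y : R} (hy : y ∈ powTorsionIdeal x) : d y ∈ powTorsionIdeal x := by
  obtain ⟨n, hn⟩ := hy
  refine ⟨n + n, ?_⟩
  have h : d (x ^ n * y) = 0 := by rw [hn, map_zero]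
  rw [d.leibniz, smul_eq_mul, smul_eq_mul] at h
  rw [pow_add]
  linear_combination x ^ n * h - d (x ^ n) * hn

/-- In a nonzero differentially simple differential ring, every zero divisor
is nilpotent. -/
theorem diffSimple_zeroDivisor_nilpotent (R : Type*) [CommRing R] [Nontrivial R]
    (dR : Derivation ℤ R R)
    (hsimple : ∀ I : Ideal R, (∀ x ∈ I, dR x ∈ I) → I = ⊥ ∨ I = ⊤) :
    ∀ x : R, (∃ y : R, y ≠ 0 ∧ x * y = 0) → IsNilpotent x := by
  rintro x ⟨y, hy, hxy⟩
  rcases hsimple (powTorsionIdeal x) fun _ h => dR.apply_mem_powTorsionIdeal h with h | h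
  · have hmem : y ∈ powTorsionIdeal x := mem_powTorsionIdeal.2 ⟨1, by rwa [pow_one]⟩
    rw [h, Ideal.mem_bot] at hmem
    exact absurd hmem hy
  · obtain ⟨n, hn⟩ := mem_powTorsionIdeal.1 ((Ideal.eq_top_iff_one _).1 h)
    exact ⟨n, by rwa [mul_one] at hn⟩
end

section
/- Let F be a differential field of characteristic zero with field of constants K, let A ∈ Mₙ(F), and let R be a Picard-Vessiot ring over F for A, generated by a fundamental solution matrix Y ∈ GLₙ(R). Let S be a differential ring extension of F which is an integral domain whose fraction field has field of constants K, and assume there exists X ∈ GLₙ(S) with ∂(X) = AX. Equip S ⊗_F R with the unique derivation satisfying ∂(s ⊗ r) = ∂(s) ⊗ r + s ⊗ ∂(r), and let U ⊆ S ⊗_F R be the K-subalgebra of constants. Then U is a finitely generated K-algebra, and the S-linear map θ : S ⊗_K U → S ⊗_F R sending s ⊗ u to (s ⊗ 1)·u is bijective, hence an isomorphism of differential rings (where S ⊗_K U carries the derivation determined by ∂(s ⊗ u) = ∂(s) ⊗ u). -/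
/-- `R` is a Picard-Vessiot ring over the differential field `F` (with derivation `dF` and
field of constants `K`) for the linear differential equation `∂w = A w`: it is a differential
ring extension of `F`, generated by a fundamental solution matrix `W` together with
`det W⁻¹` (equivalently by the entries of `W` and of `W⁻¹`), it is an integral domain, the
field of constants of its fraction field is `K` (an element `x/y` of the fraction field is
constant iff `∂x · y = x · ∂y`, and it lies in `K` iff `x = c·y` for some `c ∈ K`), and it is
differentially simple. -/
structure IsPicardVessiotRing (K : Type*) [Field K] (F : Type*) [Field F] [Algebra K F]
    (R : Type*) [CommRing R] [Algebra F R]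
    (dF : Derivation ℤ F F) (dR : Derivation ℤ R R)
    {n : ℕ} (A : Matrix (Fin n) (Fin n) F) : Prop where
  extends_deriv : ∀ f : F, dR (algebraMap F R f) = algebraMap F R (dF f)
  isDomain : IsDomain R
  exists_fundamental : ∃ W W' : Matrix (Fin n) (Fin n) R,
    W * W' = 1 ∧ W' * W = 1 ∧
    (∀ i j, dR (W i j) = (A.map (algebraMap F R) * W) i j) ∧
    Algebra.adjoin F ({x | ∃ i j, W i j = x} ∪ {x | ∃ i j, W' i j = x}) = ⊤
  constants_fraction : ∀ x y : R, y ≠ 0 → dR x * y = x * dR y →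
    ∃ c : K, x = algebraMap F R (algebraMap K F c) * y
  simple : ∀ I : Ideal R, (∀ x ∈ I, dR x ∈ I) → I = ⊥ ∨ I = ⊤

theorem Matrix.map_derivation_mul {T : Type*} [CommRing T] (d : Derivation ℤ T T) {n : ℕ}
    (M N : Matrix (Fin n) (Fin n) T) :
    (M * N).map d = M.map d * N + M * N.map d := by
  ext i j
  simp [Matrix.mul_apply, map_sum, Finset.sum_add_distrib, mul_comm, add_comm]

theorem Matrix.map_mul_map_eq_one {B T : Type*} [CommRing B] [CommRing T] (f : B →+* T) {n : ℕ}
    {M N : Matrix (Fin n) (Fin n) B} (h : M * N = 1) : M.map f * N.map f = 1 := by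
  rw [← Matrix.map_mul, h, Matrix.map_one _ (map_zero _) (map_one _)]

/-- The quotient of two fundamental solution matrices is constant. -/
theorem Matrix.map_derivation_inv_mul_eq_zero {T : Type*} [CommRing T] (d : Derivation ℤ T T)
    {n : ℕ} {A X X' Y : Matrix (Fin n) (Fin n) T} (hXX' : X * X' = 1) (hX'X : X' * X = 1)
    (hX : X.map d = A * X) (hY : Y.map d = A * Y) :
    (X' * Y).map d = 0 := by
  have h1 : (1 : Matrix (Fin n) (Fin n) T).map d = 0 := by
    ext i j
    by_cases h : i = j <;> simp [h]
  have h2 : X'.map d * X + X' * (A * X) = 0 := by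
    rw [← hX, ← Matrix.map_derivation_mul, hX'X, h1]
  have h3 : X'.map d + X' * A = 0 := by
    calc X'.map d + X' * A = (X'.map d * X + X' * (A * X)) * X' := by
          rw [add_mul, mul_assoc, mul_assoc, mul_assoc, hXX', mul_one, mul_one]
      _ = 0 := by rw [h2, zero_mul]
  rw [Matrix.map_derivation_mul, hY, ← mul_assoc, ← add_mul, h3, zero_mul]

/-- Constants of a differential module which are linearly independent over the field of constants
are linearly independent over the differential ring. -/
theorem LinearIndependent.of_derivation_constants {K S M ι : Type*} [Field K] [CommRing S]
    [IsDomain S] [Algebra K S] [AddCommGroup M] [Module K M] [Module S M] [IsScalarTower K S M]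
    [Module.IsTorsionFree S M] (dS : Derivation ℤ S S)
    (hconst : ∀ x y : S, y ≠ 0 → dS x * y = x * dS y → ∃ c : K, x = algebraMap K S c * y)
    (D : M →+ M) (hD : ∀ (s : S) (m : M), D (s • m) = dS s • m + s • D m)
    {v : ι → M} (hv : ∀ i, D (v i) = 0) (hli : LinearIndependent K v) :
    LinearIndependent S v := by
  classical
  rw [linearIndependent_iff']
  intro s
  induction s using Finset.induction_on with
  | empty => simp
  | insert a s ha ih =>
    intro g hg
    by_cases hga : g a = 0
    · rw [Finset.sum_insert ha, hga, zero_smul, zero_add] at hg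
      simpa [hga] using ih g hg
    · exfalso
      have hdg : ∑ i ∈ insert a s, dS (g i) • v i = 0 := by
        simpa [map_sum, hD, hv] using congrArg D hg
      have hcomb : ∑ i ∈ insert a s, (g a * dS (g i) - dS (g a) * g i) • v i = 0 := by
        simp only [sub_smul, mul_smul, Finset.sum_sub_distrib, ← Finset.smul_sum, hg, hdg,
          smul_zero, sub_zero]
      rw [Finset.sum_insert ha, mul_comm (dS (g a)), sub_self, zero_smul, zero_add] at hcomb
      have hc : ∀ i ∈ insert a s, ∃ c : K, g i = algebraMap K S c * g a := by
        intro i hi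
        refine hconst (g i) (g a) hga ?_
        rcases Finset.mem_insert.1 hi with rfl | hi
        · exact mul_comm _ _
        · linear_combination ih _ hcomb i hi
      choose! c hc using hc
      have hsum : ∑ i ∈ insert a s, c i • v i = 0 := by
        refine (smul_eq_zero_iff_right hga).1 ?_
        rw [Finset.smul_sum, ← hg]
        refine Finset.sum_congr rfl fun i hi => ?_
        rw [hc i hi, mul_comm, mul_smul, algebraMap_smul]
      have h0 := linearIndependent_iff'.1 hli _ c hsum a (Finset.mem_insert_self a s)
      apply hga
      rw [hc a (Finset.mem_insert_self a s), h0, map_zero, zero_mul]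

open TensorProduct in
theorem LinearMap.liftBaseChange_injective_of_linearIndependent {K S M N : Type*} [Field K]
    [CommRing S] [Algebra K S] [AddCommGroup M] [Module K M] [AddCommGroup N] [Module K N]
    [Module S N] [IsScalarTower K S N] {ι : Type*} (b : Module.Basis ι K M) (f : M →ₗ[K] N)
    (h : LinearIndependent S (f ∘ b)) : Function.Injective (f.liftBaseChange S) := by
  refine LinearMap.injective_of_linearIndependent (Algebra.TensorProduct.basis S b).span_eq ?_
  have hb : f.liftBaseChange S ∘ Algebra.TensorProduct.basis S b = f ∘ b := by
    ext i
    simp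
  rw [hb]
  exact h

open TensorProduct in
/-- A `K`-subalgebra of `S ⊗[F] R` containing the entries of the matrices `X⁻¹ Y` and `Y⁻¹ X`
spans `S ⊗[F] R` over `S` as soon as `R` is generated by the entries of `Y` and `Y⁻¹`. -/
theorem Algebra.TensorProduct.liftBaseChange_surjective_of_matrix {K F R S : Type*} [Field K] [Field F]
    [Algebra K F] [CommRing R] [Algebra F R] [CommRing S] [Algebra F S] [Algebra K S]
    [IsScalarTower K F S] {n : ℕ} {X X' : Matrix (Fin n) (Fin n) S} (hXX' : X * X' = 1)
    {Y Y' : Matrix (Fin n) (Fin n) R}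
    (hgen : Algebra.adjoin F ({x | ∃ i j, Y i j = x} ∪ {x | ∃ i j, Y' i j = x}) = ⊤)
    (V : Subalgebra K (S ⊗[F] R))
    (hZ : ∀ i j, (X'.map (· ⊗ₜ[F] (1 : R)) * Y.map ((1 : S) ⊗ₜ[F] ·)) i j ∈ V)
    (hZ' : ∀ i j, (Y'.map ((1 : S) ⊗ₜ[F] ·) * X.map (· ⊗ₜ[F] (1 : R))) i j ∈ V) :
    Function.Surjective (V.val.toLinearMap.liftBaseChange S) := by
  set P : Subalgebra S (S ⊗[F] R) :=
    (Algebra.TensorProduct.lift (Algebra.ofId S (S ⊗[F] R)) V.val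
      fun _ _ => Commute.all _ _).range
  have hVP : ∀ x ∈ V, x ∈ P := fun x hx => ⟨1 ⊗ₜ ⟨x, hx⟩, by
    simp [← Algebra.TensorProduct.one_def]⟩
  have hSP : ∀ s : S, s ⊗ₜ[F] (1 : R) ∈ P := fun s => P.algebraMap_mem s
  have hXm : X.map (· ⊗ₜ[F] (1 : R)) * X'.map (· ⊗ₜ[F] (1 : R)) = 1 :=
    Matrix.map_mul_map_eq_one
      (Algebra.TensorProduct.includeLeftRingHom : S →+* S ⊗[F] R) hXX'
  have hY : ∀ i j, (1 : S) ⊗ₜ[F] Y i j ∈ P := by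
    intro i j
    have h : Y.map ((1 : S) ⊗ₜ[F] ·) = X.map (· ⊗ₜ[F] (1 : R)) *
        (X'.map (· ⊗ₜ[F] (1 : R)) * Y.map ((1 : S) ⊗ₜ[F] ·)) := by
      rw [← mul_assoc, hXm, one_mul]
    have h' := congrFun (congrFun h i) j
    rw [Matrix.map_apply, Matrix.mul_apply] at h'
    rw [h']
    exact sum_mem fun k _ => mul_mem (hSP _) (hVP _ (hZ k j))
  have hY' : ∀ i j, (1 : S) ⊗ₜ[F] Y' i j ∈ P := by
    intro i j
    have h : Y'.map ((1 : S) ⊗ₜ[F] ·) = (Y'.map ((1 : S) ⊗ₜ[F] ·) * X.map (· ⊗ₜ[F] (1 : R))) *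
        X'.map (· ⊗ₜ[F] (1 : R)) := by
      rw [mul_assoc, hXm, mul_one]
    have h' := congrFun (congrFun h i) j
    rw [Matrix.map_apply, Matrix.mul_apply] at h'
    rw [h']
    exact sum_mem fun k _ => mul_mem (hVP _ (hZ' i k)) (hSP _)
  have hR : ∀ r : R, (1 : S) ⊗ₜ[F] r ∈ P := by
    intro r
    have hr : r ∈ Algebra.adjoin F ({x | ∃ i j, Y i j = x} ∪ {x | ∃ i j, Y' i j = x}) := by
      rw [hgen]; trivial
    induction hr using Algebra.adjoin_induction with
    | mem x hx =>
      rcases hx with ⟨i, j, rfl⟩ | ⟨i, j, rfl⟩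
      · exact hY i j
      · exact hY' i j
    | algebraMap f =>
      rw [Algebra.algebraMap_eq_smul_one, TensorProduct.tmul_smul, TensorProduct.smul_tmul']
      exact hSP _
    | add x y _ _ hx hy => rw [TensorProduct.tmul_add]; exact add_mem hx hy
    | mul x y _ _ hx hy =>
      rw [← one_mul (1 : S), ← Algebra.TensorProduct.tmul_mul_tmul]
      exact mul_mem hx hy
  intro x
  have hx : x ∈ P := by
    induction x using TensorProduct.induction_on with
    | zero => exact zero_mem _
    | add x y hx hy => exact add_mem hx hy
    | tmul s r =>
      have := mul_mem (hSP s) (hR r)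
      rwa [Algebra.TensorProduct.tmul_mul_tmul, mul_one, one_mul] at this
  obtain ⟨y, rfl⟩ := hx
  refine ⟨y, ?_⟩
  induction y using TensorProduct.induction_on with
  | zero => simp
  | add x y hx hy => simpa using congrArg₂ (· + ·) hx hy
  | tmul s u => simp [Algebra.smul_def, Algebra.ofId_apply]

set_option synthInstance.maxHeartbeats 1000000
set_option maxHeartbeats 1000000

open TensorProduct in
/-- the fundamental lemma of Picard-Vessiot theory. Let `R` be a
Picard-Vessiot ring over `F` for `A` (generated by a fundamental solution matrix `Y`), and let
`S` be a geometric differential ring extension of `F` (an integral domain whose fraction field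
has field of constants `K`) admitting a fundamental solution matrix `X ∈ GLₙ(S)` for `A`.
Equip `S ⊗_F R` with the derivation `dT` satisfying `dT (s ⊗ r) = dS s ⊗ r + s ⊗ dR r` and let
`U` be the `K`-subalgebra of constants of `S ⊗_F R`. Then `U` is a finitely generated
`K`-algebra, and the `S`-linear map `θ : S ⊗_K U → S ⊗_F R`, `s ⊗ u ↦ (s ⊗ 1)·u`, is
bijective; moreover `θ` commutes with the derivations (where `S ⊗_K U` carries the derivation
determined by `d(s ⊗ u) = dS s ⊗ u`), hence is an isomorphism of differential rings. -/
theorem fundamental_lemma (K F R S : Type*) [Field K] [Field F] [CharZero F] [Algebra K F]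
    [CommRing R] [Algebra F R]
    [CommRing S] [IsDomain S] [Algebra F S] [Algebra K S] [IsScalarTower K F S]
    (dF : Derivation ℤ F F) (dR : Derivation ℤ R R) (dS : Derivation ℤ S S)
    (hK : ∀ f : F, dF f = 0 ↔ f ∈ Set.range (algebraMap K F))
    (n : ℕ) (A : Matrix (Fin n) (Fin n) F)
    (hR : IsPicardVessiotRing K F R dF dR A)
    (hSext : ∀ f : F, dS (algebraMap F S f) = algebraMap F S (dF f))
    (hSconst : ∀ x y : S, y ≠ 0 → dS x * y = x * dS y →
      ∃ c : K, x = algebraMap F S (algebraMap K F c) * y)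
    (X X' : Matrix (Fin n) (Fin n) S) (hXX' : X * X' = 1) (hX'X : X' * X = 1)
    (hX : ∀ i j, dS (X i j) = (A.map (algebraMap F S) * X) i j)
    (dT : Derivation ℤ (S ⊗[F] R) (S ⊗[F] R))
    (hdT : ∀ (s : S) (r : R), dT (s ⊗ₜ[F] r) = dS s ⊗ₜ[F] r + s ⊗ₜ[F] dR r)
    (U : Subalgebra K (S ⊗[F] R)) (hU : ∀ x : S ⊗[F] R, x ∈ U ↔ dT x = 0)
    (θ : S ⊗[K] U →ₐ[K] S ⊗[F] R)
    (hθ : θ = Algebra.TensorProduct.productMap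
      (Algebra.TensorProduct.includeLeft : S →ₐ[K] S ⊗[F] R) U.val) :
    U.FG ∧
    (∀ (s : S) (u : U), θ (s ⊗ₜ[K] u) = (s ⊗ₜ[F] (1 : R)) * (u : S ⊗[F] R)) ∧
    Function.Bijective θ ∧
    (∀ dT' : Derivation ℤ (S ⊗[K] U) (S ⊗[K] U),
      (∀ (s : S) (u : U), dT' (s ⊗ₜ[K] u) = dS s ⊗ₜ[K] u) →
      ∀ x : S ⊗[K] U, θ (dT' x) = dT (θ x)) := by
  obtain ⟨Y, Y', hYY', hY'Y, hY, hgen⟩ := hR.exists_fundamental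
  have hθ_tmul : ∀ (s : S) (u : U),
      θ (s ⊗ₜ[K] u) = (s ⊗ₜ[F] (1 : R)) * (u : S ⊗[F] R) := by
    intro s u
    simp [hθ]
  have hθ_lift : ∀ x, θ x = U.val.toLinearMap.liftBaseChange S x := by
    intro x
    induction x using TensorProduct.induction_on with
    | zero => simp
    | add x y hx hy => rw [map_add, map_add, hx, hy]
    | tmul s u =>
      rw [hθ_tmul, LinearMap.liftBaseChange_tmul, Algebra.smul_def]
      rfl
  have hdT_left : ∀ s : S, dT (s ⊗ₜ[F] (1 : R)) = dS s ⊗ₜ[F] (1 : R) := by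
    intro s
    simp [hdT]
  have hdT_right : ∀ r : R, dT ((1 : S) ⊗ₜ[F] r) = (1 : S) ⊗ₜ[F] dR r := by
    intro r
    simp [hdT]
  -- Both fundamental matrices become fundamental matrices over `S ⊗[F] R`.
  let ι₁ : S →+* S ⊗[F] R := Algebra.TensorProduct.includeLeftRingHom
  let ι₂ : R →+* S ⊗[F] R := (Algebra.TensorProduct.includeRight : R →ₐ[F] S ⊗[F] R).toRingHom
  have hA : (A.map (algebraMap F R)).map ι₂ = (A.map (algebraMap F S)).map ι₁ := by
    ext i j
    simp [ι₁, ι₂, Algebra.algebraMap_eq_smul_one, TensorProduct.smul_tmul']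
  have hX₁ : (X.map ι₁).map dT = (A.map (algebraMap F S)).map ι₁ * X.map ι₁ := by
    rw [← Matrix.map_mul]
    ext i j
    exact (hdT_left _).trans (congrArg ι₁ (hX i j))
  have hY₂ : (Y.map ι₂).map dT = (A.map (algebraMap F S)).map ι₁ * Y.map ι₂ := by
    rw [← hA, ← Matrix.map_mul]
    ext i j
    exact (hdT_right _).trans (congrArg ι₂ (hY i j))
  set Z := X'.map ι₁ * Y.map ι₂ with hZdef
  set Z' := Y'.map ι₂ * X.map ι₁ with hZ'def
  have hZ : ∀ i j, Z i j ∈ U := fun i j => (hU _).2 <| congrFun (congrFun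
    (Matrix.map_derivation_inv_mul_eq_zero dT
      (Matrix.map_mul_map_eq_one ι₁ hXX') (Matrix.map_mul_map_eq_one ι₁ hX'X) hX₁ hY₂) i) j
  have hZ' : ∀ i j, Z' i j ∈ U := fun i j => (hU _).2 <| congrFun (congrFun
    (Matrix.map_derivation_inv_mul_eq_zero dT
      (Matrix.map_mul_map_eq_one ι₂ hYY') (Matrix.map_mul_map_eq_one ι₂ hY'Y) hY₂ hX₁) i) j
  have hinj : Function.Injective (U.val.toLinearMap.liftBaseChange S) := by
    let b := Module.Basis.ofVectorSpace K U
    refine LinearMap.liftBaseChange_injective_of_linearIndependent b _ ?_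
    refine LinearIndependent.of_derivation_constants (K := K) dS ?_ (dT : S ⊗[F] R →+ S ⊗[F] R)
      ?_ (fun i => (hU _).1 (b i).2) ?_
    · intro x y hy hxy
      rw [IsScalarTower.algebraMap_eq K F S]
      exact hSconst x y hy hxy
    · intro s m
      have : ∀ (s : S) (m : S ⊗[F] R), s • m = s ⊗ₜ[F] (1 : R) * m := fun s m => by
        rw [Algebra.smul_def]; rfl
      simp only [this, AddMonoidHom.coe_coe, Derivation.leibniz, hdT_left, smul_eq_mul]
      ring
    · exact b.linearIndependent.map' _ (LinearMap.ker_eq_bot.2 Subtype.val_injective)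
  let G : Set (S ⊗[F] R) :=
    Set.range (fun p : Fin n × Fin n => Z p.1 p.2) ∪ Set.range fun p : Fin n × Fin n => Z' p.1 p.2
  have hGU : Algebra.adjoin K G ≤ U := by
    rw [Algebra.adjoin_le_iff]
    rintro _ (⟨p, rfl⟩ | ⟨p, rfl⟩)
    exacts [hZ _ _, hZ' _ _]
  have hsurjG := Algebra.TensorProduct.liftBaseChange_surjective_of_matrix hXX' hgen
    (Algebra.adjoin K G)
    (fun i j => Algebra.subset_adjoin (Or.inl ⟨(i, j), rfl⟩))
    (fun i j => Algebra.subset_adjoin (Or.inr ⟨(i, j), rfl⟩))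
  have hsurj := Algebra.TensorProduct.liftBaseChange_surjective_of_matrix hXX' hgen
    U hZ hZ'
  refine ⟨?_, hθ_tmul, ?_, ?_⟩
  · have hincl : Function.Surjective (Subalgebra.inclusion hGU).toLinearMap := by
      rw [← Module.FaithfullyFlat.lTensor_surjective_iff_surjective K S]
      intro x
      obtain ⟨y, hy⟩ := hsurjG (U.val.toLinearMap.liftBaseChange S x)
      refine ⟨y, hinj (Eq.trans ?_ hy)⟩
      clear hy
      induction y using TensorProduct.induction_on with
      | zero => simp
      | add x y hx hy => rw [map_add, map_add, map_add, hx, hy]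
      | tmul s u => simp
    have hUG : U = Algebra.adjoin K G := by
      refine le_antisymm (fun u hu => ?_) hGU
      obtain ⟨g, hg⟩ := hincl ⟨u, hu⟩
      rw [← show (g : S ⊗[F] R) = u from congrArg Subtype.val hg]
      exact g.2
    rw [hUG]
    exact Subalgebra.fg_def.2 ⟨G, (Set.finite_range _).union (Set.finite_range _), rfl⟩
  · rw [show (θ : S ⊗[K] U → S ⊗[F] R) = U.val.toLinearMap.liftBaseChange S from funext hθ_lift]
    exact ⟨hinj, hsurj⟩
  · intro dT' hdT' x
    induction x using TensorProduct.induction_on with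
    | zero => simp
    | add x y hx hy => simp only [map_add, hx, hy]
    | tmul s u =>
      rw [hdT', hθ_tmul, hθ_tmul, Derivation.leibniz, (hU _).1 u.2, hdT_left, smul_zero, zero_add,
        smul_eq_mul, mul_comm]
end

section
/- Let F be a differential field of characteristic zero whose field of constants K is algebraically closed, and let A ∈ Mₙ(F). Let E/F be a Picard-Vessiot extension for A and let R/F be a Picard-Vessiot ring for A. Then there exists an injective homomorphism of differential F-algebras R → E, i.e. an injective ring homomorphism over F commuting with the derivations. In particular, E is the fraction field of a Picard-Vessiot ring over F. -/
/-- `E` is a Picard-Vessiot (field) extension of the differential field `F` (with derivation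
`dF` and field of constants `K`) for the equation `∂w = A w`: it is a differential field
extension of `F` generated by the entries of a fundamental solution matrix `W ∈ GLₙ(E)` for
`A`, and its field of constants is `K`. -/
structure IsPicardVessiotExtension (K : Type*) [Field K] (F : Type*) [Field F] [Algebra K F]
    (E : Type*) [Field E] [Algebra F E]
    (dF : Derivation ℤ F F) (dE : Derivation ℤ E E)
    {n : ℕ} (A : Matrix (Fin n) (Fin n) F) : Prop where
  extends_deriv : ∀ f : F, dE (algebraMap F E f) = algebraMap F E (dF f)
  exists_fundamental : ∃ W W' : Matrix (Fin n) (Fin n) E,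
    W * W' = 1 ∧ W' * W = 1 ∧
    (∀ i j, dE (W i j) = (A.map (algebraMap F E) * W) i j) ∧
    IntermediateField.adjoin F {x | ∃ i j, W i j = x} = ⊤
  constants : ∀ x : E, dE x = 0 ↔ ∃ c : K, x = algebraMap F E (algebraMap K F c)

open scoped TensorProduct

theorem linearIndependent_of_deriv_eq_zero {K E T ι : Type*} [Field K] [Field E] [CommRing T]
    [Algebra K E] [Algebra E T] [Algebra K T] [IsScalarTower K E T]
    (dE : Derivation ℤ E E) (D : Derivation ℤ T T)
    (hD : ∀ e, D (algebraMap E T e) = algebraMap E T (dE e))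
    (hconst : ∀ e, dE e = 0 → ∃ c : K, e = algebraMap K E c)
    (v : ι → T) (hv : ∀ i, D (v i) = 0) (hli : LinearIndependent K v) :
    LinearIndependent E v := by
  classical
  rw [linearIndependent_iff']
  intro s
  induction s using Finset.induction_on with
  | empty => simp
  | insert a s ha ih =>
    intro g hg
    have hga : g a = 0 := by
      by_contra hga
      have hsum : ∑ i ∈ insert a s, ((g a)⁻¹ * g i) • v i = 0 := by
        simp_rw [mul_smul, ← Finset.smul_sum, hg, smul_zero]
      have hDsum : ∑ i ∈ s, dE ((g a)⁻¹ * g i) • v i = 0 := by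
        have h := congrArg D hsum
        rw [map_sum, map_zero, Finset.sum_insert ha] at h
        simpa [Algebra.smul_def, -map_mul, hv, hD, inv_mul_cancel₀ hga, mul_comm] using h
      have hdz := ih _ hDsum
      have hc : ∀ i ∈ insert a s, ∃ c : K, (g a)⁻¹ * g i = algebraMap K E c := by
        intro i hi
        apply hconst
        rcases Finset.mem_insert.1 hi with rfl | hi
        · simp [inv_mul_cancel₀ hga]
        · exact hdz i hi
      choose! c hc using hc
      have hK : ∑ i ∈ insert a s, c i • v i = 0 := by
        rw [← hsum]
        refine Finset.sum_congr rfl fun i hi => ?_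
        rw [hc i hi, algebraMap_smul]
      have hca := linearIndependent_iff'.1 hli _ _ hK a (Finset.mem_insert_self _ _)
      have := hc a (Finset.mem_insert_self _ _)
      simp [hca, inv_mul_cancel₀ hga] at this
    intro i hi
    rw [Finset.sum_insert ha, hga, zero_smul, zero_add] at hg
    rcases Finset.mem_insert.1 hi with rfl | hi
    · exact hga
    · exact ih g hg i hi

theorem exists_algHom_of_finiteType (K C : Type*) [Field K] [IsAlgClosed K] [CommRing C]
    [Nontrivial C] [Algebra K C] [Algebra.FiniteType K C] : Nonempty (C →ₐ[K] K) := by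
  obtain ⟨m, hm⟩ := Ideal.exists_maximal C
  let : Field (C ⧸ m) := Ideal.Quotient.field m
  have : Module.Finite K (C ⧸ m) := finite_of_finite_type_of_isJacobsonRing K (C ⧸ m)
  let e : K ≃ₐ[K] (C ⧸ m) := AlgEquiv.ofBijective (Algebra.ofId K (C ⧸ m))
    (IsAlgClosed.algebraMap_bijective_of_isIntegral (k := K))
  exact ⟨e.symm.toAlgHom.comp (Ideal.Quotient.mkₐ K m)⟩

theorem exists_algHom_of_adjoin_constants {K E T : Type*} [Field K] [IsAlgClosed K] [Field E]
    [CommRing T] [Nontrivial T] [Algebra K E] [Algebra E T] [Algebra K T] [IsScalarTower K E T]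
    (dE : Derivation ℤ E E) (D : Derivation ℤ T T)
    (hD : ∀ e, D (algebraMap E T e) = algebraMap E T (dE e))
    (hconst : ∀ e, dE e = 0 ↔ ∃ c : K, e = algebraMap K E c)
    {S : Set T} (hfin : S.Finite) (hS : ∀ s ∈ S, D s = 0) (htop : Algebra.adjoin E S = ⊤) :
    ∃ ψ : T →ₐ[E] E, ∀ s ∈ S, ∃ c : K, ψ s = algebraMap K E c := by
  let C := Algebra.adjoin K S
  have hC : ∀ x : C, D (x : T) = 0 := by
    rintro ⟨x, hx⟩
    induction hx using Algebra.adjoin_induction with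
    | mem x hx => exact hS x hx
    | algebraMap c =>
      change D (algebraMap K T c) = 0
      rw [IsScalarTower.algebraMap_apply K E T, hD, (hconst _).2 ⟨c, rfl⟩, map_zero]
    | add x y _ _ hx hy => simp_all
    | mul x y _ _ hx hy => simp_all
  have : Algebra.FiniteType K C :=
    (Subalgebra.fg_iff_finiteType _).1 (Subalgebra.fg_def.2 ⟨S, hfin, rfl⟩)
  obtain ⟨φ⟩ := exists_algHom_of_finiteType K C
  let μ : E ⊗[K] C →ₐ[E] T :=
    Algebra.TensorProduct.lift (Algebra.ofId E T) C.val fun _ _ => Commute.all _ _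
  have hinj : Function.Injective μ := by
    let b := Module.Free.chooseBasis K C
    have hli : LinearIndependent E fun i => (b i : T) :=
      linearIndependent_of_deriv_eq_zero dE D hD (fun e => (hconst e).1) _ (fun i => hC (b i))
        (b.linearIndependent.map' C.val.toLinearMap
          (LinearMap.ker_eq_bot.2 Subtype.val_injective))
    have hμ : μ.toLinearMap = (Finsupp.linearCombination E fun i => (b i : T)) ∘ₗ
        (Algebra.TensorProduct.basis E b).repr.toLinearMap := by
      refine (Algebra.TensorProduct.basis E b).ext fun i => ?_
      simp only [LinearMap.comp_apply, LinearEquiv.coe_coe, Algebra.TensorProduct.basis_apply,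
        Algebra.TensorProduct.basis_repr_tmul]
      simp [μ]
    have h : Function.Injective μ.toLinearMap := by
      rw [hμ]
      exact Function.Injective.comp (g := Finsupp.linearCombination E fun i => (b i : T)) hli
        (Algebra.TensorProduct.basis E b).repr.injective
    exact h
  have hsurj : Function.Surjective μ := by
    rw [← AlgHom.range_eq_top, eq_top_iff, ← htop, Algebra.adjoin_le_iff]
    intro s hs
    exact ⟨1 ⊗ₜ ⟨s, Algebra.subset_adjoin hs⟩, by simp [μ]⟩
  let e := AlgEquiv.ofBijective μ ⟨hinj, hsurj⟩
  let ev : E ⊗[K] C →ₐ[E] E :=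
    Algebra.TensorProduct.lift (AlgHom.id E E) ((Algebra.ofId K E).comp φ)
      fun _ _ => Commute.all _ _
  refine ⟨ev.comp e.symm.toAlgHom, fun s hs => ⟨φ ⟨s, Algebra.subset_adjoin hs⟩, ?_⟩⟩
  have : e.symm s = 1 ⊗ₜ ⟨s, Algebra.subset_adjoin hs⟩ := by
    rw [AlgEquiv.symm_apply_eq]
    have h : μ (1 ⊗ₜ ⟨s, Algebra.subset_adjoin hs⟩) = s := by simp [μ]
    exact h.symm
  simp [this, ev, Algebra.ofId_apply]

theorem exists_derivation_tensorProduct {F E R : Type*} [Field F] [CommRing E] [CommRing R]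
    [Algebra F E] [Algebra F R]
    (dF : Derivation ℤ F F) (dE : Derivation ℤ E E) (dR : Derivation ℤ R R)
    (hE : ∀ f, dE (algebraMap F E f) = algebraMap F E (dF f))
    (hR : ∀ f, dR (algebraMap F R f) = algebraMap F R (dF f)) :
    ∃ D : Derivation ℤ (E ⊗[F] R) (E ⊗[F] R),
      ∀ e r, D (e ⊗ₜ r) = dE e ⊗ₜ r + e ⊗ₜ dR r := by
  let d : E →+ R →+ E ⊗[F] R := AddMonoidHom.mk' (fun e => AddMonoidHom.mk'
      (fun r => dE e ⊗ₜ r + e ⊗ₜ dR r)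
      (fun r s => by simp only [TensorProduct.tmul_add, map_add]; abel))
    (fun e e' => by
      ext r
      simp only [AddMonoidHom.mk'_apply, AddMonoidHom.add_apply, TensorProduct.add_tmul, map_add]
      abel)
  have hd : ∀ (f : F) (e : E) (r : R), d (f • e) r = d e (f • r) := by
    intro f e r
    have h1 : dE (f • e) = f • dE e + dF f • e := by
      rw [Algebra.smul_def, Derivation.leibniz, hE]
      simp only [Algebra.smul_def, Algebra.algebraMap_self_apply]
      ring
    have h2 : dR (f • r) = f • dR r + dF f • r := by
      rw [Algebra.smul_def, Derivation.leibniz, hR]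
      simp only [Algebra.smul_def, Algebra.algebraMap_self_apply]
      ring
    simp only [d, AddMonoidHom.mk'_apply, h1, h2, TensorProduct.tmul_add, TensorProduct.add_tmul,
      TensorProduct.smul_tmul]
    abel
  let δ : E ⊗[F] R →+ E ⊗[F] R := TensorProduct.liftAddHom d hd
  have hδ : ∀ e r, δ (e ⊗ₜ r) = dE e ⊗ₜ r + e ⊗ₜ dR r := fun e r => rfl
  refine ⟨Derivation.mk' δ.toIntLinearMap fun x y => ?_, hδ⟩
  change δ (x * y) = x * δ y + y * δ x
  induction x using TensorProduct.induction_on with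
  | zero => simp
  | add x x' hx hx' => rw [add_mul, map_add, hx, hx', map_add]; ring
  | tmul e r =>
    induction y using TensorProduct.induction_on with
    | zero => simp
    | add y y' hy hy' => rw [mul_add, map_add, hy, hy', map_add]; ring
    | tmul e' r' =>
      simp only [Algebra.TensorProduct.tmul_mul_tmul, hδ, Derivation.leibniz, smul_eq_mul,
        TensorProduct.tmul_add, TensorProduct.add_tmul, mul_add]
      rw [mul_comm r r', mul_comm e e', mul_comm r' r, mul_comm r (dR r'), mul_comm (dR r') r]
      simp only [mul_comm]
      abel

namespace Matrix

theorem map_derivation_mul_s4 {T n : Type*} [CommRing T] [Fintype n] (D : Derivation ℤ T T)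
    (M N : Matrix n n T) :
    (M * N).map D = M.map D * N + M * N.map D := by
  ext i j
  simp only [map_apply, mul_apply, add_apply, map_sum, Derivation.leibniz, smul_eq_mul,
    ← Finset.sum_add_distrib]
  exact Finset.sum_congr rfl fun k _ => by ring

variable {T n : Type*} [CommRing T] [Fintype n] [DecidableEq n] (D : Derivation ℤ T T)

theorem map_derivation_inv {A W W' : Matrix n n T} (h : W * W' = 1) (h' : W' * W = 1)
    (hW : W.map D = A * W) : W'.map D = -(W' * A) := by
  have h1 := map_derivation_mul_s4 D W W'
  have h0 : (1 : Matrix n n T).map D = 0 := by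
    ext i j
    by_cases hij : i = j <;> simp [hij]
  rw [h, h0, hW, mul_assoc, h, mul_one] at h1
  calc W'.map D = W' * (W * W'.map D) := by rw [← mul_assoc, h', one_mul]
    _ = -(W' * A) := by rw [eq_neg_of_add_eq_zero_right h1.symm, mul_neg]

theorem map_derivation_inv_mul {A W V V' : Matrix n n T} (h : V * V' = 1) (h' : V' * V = 1)
    (hW : W.map D = A * W) (hV : V.map D = A * V) : (V' * W).map D = 0 := by
  rw [map_derivation_mul_s4, map_derivation_inv D h h' hV, hW, neg_mul, mul_assoc, neg_add_cancel]

theorem map_algHom_derivation_eq {F B T n : Type*} [CommRing F] [CommRing B] [CommRing T]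
    [Algebra F B] [Algebra F T] [Fintype n] (D : Derivation ℤ T T) (d : Derivation ℤ B B)
    (φ : B →ₐ[F] T) (hφ : ∀ b, D (φ b) = φ (d b)) {A : Matrix n n F} {W : Matrix n n B}
    (hW : W.map d = A.map (algebraMap F B) * W) :
    (W.map φ).map D = A.map (algebraMap F T) * W.map φ := by
  have h : (W.map φ).map D = (W.map d).map φ := by
    ext i j; exact hφ _
  rw [h, hW, Matrix.map_mul]
  congr 1
  ext i j; simp

end Matrix

/-- Over a differential field `F` of characteristic zero whose field of
constants `K` is algebraically closed, a Picard-Vessiot ring `R` for `A` embeds (as a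
differential `F`-algebra) into any Picard-Vessiot extension `E` for `A`; in particular `E` is
the fraction field of a Picard-Vessiot ring over `F` (namely of the image of `R`). -/
theorem pvRing_embeds_into_pvExtension (K F R E : Type*) [Field K] [IsAlgClosed K]
    [Field F] [CharZero F] [Algebra K F]
    [CommRing R] [Algebra F R] [Field E] [Algebra F E]
    (dF : Derivation ℤ F F) (dR : Derivation ℤ R R) (dE : Derivation ℤ E E)
    (hK : ∀ f : F, dF f = 0 ↔ f ∈ Set.range (algebraMap K F))
    (n : ℕ) (A : Matrix (Fin n) (Fin n) F)
    (hE : IsPicardVessiotExtension K F E dF dE A)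
    (hR : IsPicardVessiotRing K F R dF dR A) :
    ∃ f : R →ₐ[F] E, Function.Injective f ∧ (∀ x : R, f (dR x) = dE (f x)) ∧
      IsFractionRing f.range E := by
  have := hR.isDomain
  obtain ⟨V, V', hVV', hV'V, hV, hVtop⟩ := hE.exists_fundamental
  obtain ⟨W, W', hWW', hW'W, hW, hWtop⟩ := hR.exists_fundamental
  let : Algebra K E := ((algebraMap F E).comp (algebraMap K F)).toAlgebra
  have : IsScalarTower K F E := IsScalarTower.of_algebraMap_eq' rfl
  obtain ⟨D, hD⟩ := exists_derivation_tensorProduct dF dE dR hE.extends_deriv hR.extends_deriv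
  let iE : E →ₐ[F] E ⊗[F] R := Algebra.TensorProduct.includeLeft
  let iR : R →ₐ[F] E ⊗[F] R := Algebra.TensorProduct.includeRight
  have hDE : ∀ e, D (iE e) = iE (dE e) := fun e => by simp [iE, hD]
  have hDR : ∀ r, D (iR r) = iR (dR r) := fun r => by simp [iR, hD]
  have hVm : V.map dE = A.map (algebraMap F E) * V := Matrix.ext hV
  have hWm : W.map dR = A.map (algebraMap F R) * W := Matrix.ext hW
  have hVT := Matrix.map_algHom_derivation_eq D dE iE hDE hVm
  have hWT := Matrix.map_algHom_derivation_eq D dR iR hDR hWm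
  have hVV'T : V.map iE * V'.map iE = 1 := by rw [← Matrix.map_mul, hVV']; simp
  have hV'VT : V'.map iE * V.map iE = 1 := by rw [← Matrix.map_mul, hV'V]; simp
  have hWW'T : W.map iR * W'.map iR = 1 := by rw [← Matrix.map_mul, hWW']; simp
  have hW'WT : W'.map iR * W.map iR = 1 := by rw [← Matrix.map_mul, hW'W]; simp
  let Z := V'.map iE * W.map iR
  let Z' := W'.map iR * V.map iE
  have hZ : Z.map D = 0 := Matrix.map_derivation_inv_mul D hVV'T hV'VT hWT hVT
  have hZ' : Z'.map D = 0 := Matrix.map_derivation_inv_mul D hWW'T hW'WT hVT hWT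
  have hWZ : W.map iR = V.map iE * Z := by
    simp only [Z]; rw [← mul_assoc, hVV'T, one_mul]
  have hWZ' : W'.map iR = Z' * V'.map iE := by
    simp only [Z']; rw [mul_assoc, hVV'T, mul_one]
  let S : Set (E ⊗[F] R) := Set.range (fun p : Fin n × Fin n => Z p.1 p.2) ∪
    Set.range (fun p : Fin n × Fin n => Z' p.1 p.2)
  have hZS : ∀ i j, Z i j ∈ S := fun i j => Or.inl ⟨(i, j), rfl⟩
  have hZ'S : ∀ i j, Z' i j ∈ S := fun i j => Or.inr ⟨(i, j), rfl⟩
  have hStop : Algebra.adjoin E S = ⊤ := by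
    have hEmem : ∀ e, iE e ∈ Algebra.adjoin E S := fun e => algebraMap_mem _ e
    have hRmem : ∀ r, iR r ∈ Algebra.adjoin E S := by
      have : (⊤ : Subalgebra F R) ≤ ((Algebra.adjoin E S).restrictScalars F).comap iR := by
        rw [← hWtop, Algebra.adjoin_le_iff]
        rintro _ (⟨i, j, rfl⟩ | ⟨i, j, rfl⟩)
        · change W.map iR i j ∈ Algebra.adjoin E S
          rw [hWZ, Matrix.mul_apply]
          exact sum_mem fun k _ => mul_mem (hEmem _) (Algebra.subset_adjoin (hZS _ _))
        · change W'.map iR i j ∈ Algebra.adjoin E S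
          rw [hWZ', Matrix.mul_apply]
          exact sum_mem fun k _ => mul_mem (Algebra.subset_adjoin (hZ'S _ _)) (hEmem _)
      exact fun r => this (Algebra.mem_top (x := r))
    rw [eq_top_iff]
    rintro x -
    induction x using TensorProduct.induction_on with
    | zero => exact zero_mem _
    | add x y hx hy => exact add_mem hx hy
    | tmul e r =>
      have : e ⊗ₜ[F] r = iE e * iR r := by simp [iE, iR]
      rw [this]
      exact mul_mem (hEmem e) (hRmem r)
  obtain ⟨ψ, hψ⟩ := exists_algHom_of_adjoin_constants (K := K) dE D hDE hE.constants
    (S := S) ((Set.finite_range _).union (Set.finite_range _)) (by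
      rintro _ (⟨p, rfl⟩ | ⟨p, rfl⟩)
      · exact congrFun (congrFun hZ p.1) p.2
      · exact congrFun (congrFun hZ' p.1) p.2) hStop
  let f : R →ₐ[F] E := (ψ.restrictScalars F).comp iR
  have hψE : ∀ e, ψ (iE e) = e := fun e => ψ.commutes e
  have hfW : W.map f = V * Z.map ψ := by
    have := congrArg (fun M => M.map ψ) hWZ
    simp only [Matrix.map_mul, Matrix.map_map] at this
    rw [show ψ ∘ iE = id from funext hψE, Matrix.map_id] at this
    exact this
  have hZZ' : Z.map ψ * Z'.map ψ = 1 := by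
    rw [← Matrix.map_mul, show Z * Z' = 1 by
      simp only [Z, Z']; rw [mul_assoc, ← mul_assoc (W.map iR), hWW'T, one_mul, hV'VT]]
    simp
  have hdc : (Z.map ψ).map dE = 0 := by
    ext i j
    exact (hE.constants _).2 (hψ _ (hZS i j))
  have hfWd : (W.map f).map dE = A.map (algebraMap F E) * W.map f := by
    rw [hfW, Matrix.map_derivation_mul_s4, hdc, mul_zero, add_zero, hVm, mul_assoc]
  have hfWW' : W.map f * W'.map f = 1 := by rw [← Matrix.map_mul, hWW']; simp
  have hfW'W : W'.map f * W.map f = 1 := by rw [← Matrix.map_mul, hW'W]; simp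
  have hfA : (A.map (algebraMap F R)).map f = A.map (algebraMap F E) := by
    ext i j; simp
  have hfd : ∀ x, f (dR x) = dE (f x) := by
    intro x
    have hx : x ∈ Algebra.adjoin F ({x | ∃ i j, W i j = x} ∪ {x | ∃ i j, W' i j = x}) :=
      hWtop ▸ Algebra.mem_top
    induction hx using Algebra.adjoin_induction with
    | mem x hx =>
      rcases hx with ⟨i, j, rfl⟩ | ⟨i, j, rfl⟩
      · have h : (W.map dR).map f = (W.map f).map dE := by
          rw [hWm, hfWd, Matrix.map_mul, hfA]
        exact congrFun (congrFun h i) j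
      · have h : (W'.map dR).map f = (W'.map f).map dE := by
          rw [Matrix.map_derivation_inv dR hWW' hW'W hWm,
            Matrix.map_derivation_inv dE hfWW' hfW'W hfWd, ← hfA, ← Matrix.map_mul]
          exact Matrix.ext fun i j => map_neg f _
        exact congrFun (congrFun h i) j
    | algebraMap c => rw [hR.extends_deriv, f.commutes, f.commutes, hE.extends_deriv]
    | add x y _ _ hx hy => simp [hx, hy]
    | mul x y _ _ hx hy => simp [hx, hy]
  have hinj : Function.Injective f := by
    refine (RingHom.injective_iff_ker_eq_bot (f : R →+* E)).2 ?_
    refine (hR.simple _ fun x hx => ?_).resolve_right (RingHom.ker_ne_top _)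
    rw [RingHom.mem_ker] at hx ⊢
    exact (hfd x).trans (by rw [show f x = 0 from hx, map_zero])
  refine ⟨f, hinj, hfd, ?_⟩
  have htop : IntermediateField.adjoin F (f.range : Set E) = ⊤ := by
    rw [eq_top_iff, ← hVtop, IntermediateField.adjoin_le_iff]
    rintro _ ⟨i, j, rfl⟩
    have hVW : V = W.map f * Z'.map ψ := by rw [hfW, mul_assoc, hZZ', mul_one]
    rw [hVW, Matrix.mul_apply]
    refine sum_mem fun k _ => mul_mem (IntermediateField.subset_adjoin F _ ⟨_, rfl⟩) ?_
    obtain ⟨c, hc⟩ := hψ _ (hZ'S k j)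
    rw [Matrix.map_apply, hc]
    exact algebraMap_mem _ (algebraMap K F c)
  refine .of_field _ _ fun z => ?_
  obtain ⟨x, hx, y, hy, rfl⟩ := IntermediateField.mem_adjoin_iff_div.1
    (show z ∈ IntermediateField.adjoin F (f.range : Set E) from htop ▸ IntermediateField.mem_top)
  rw [Algebra.adjoin_eq] at hx hy
  exact ⟨⟨x, hx⟩, ⟨y, hy⟩, rfl⟩
end

section
/- Let F be a differential field of characteristic zero with field of constants K, let A ∈ Mₙ(F), and let E/F be a Picard-Vessiot extension for A generated by the fundamental solution matrix W ∈ GLₙ(E) with ∂(W) = AW. Then the F-subalgebra R = F[W_ij, det(W)⁻¹] of E is differentially simple: every ideal I ⊆ R with ∂(I) ⊆ I is either 0 or R. Consequently R is a Picard-Vessiot ring over F for A. -/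
open TensorProduct in
/-- The additive map `d₁ ⊗ 1 + 1 ⊗ d₂` on a tensor product of differential algebras over a
differential ring. -/
noncomputable def tensorDerivationAux {F E S : Type*} [CommRing F] [CommRing E] [CommRing S]
    [Algebra F E] [Algebra F S] (dF : Derivation ℤ F F) (dE : Derivation ℤ E E)
    (dS : Derivation ℤ S S) (hE : ∀ f, dE (algebraMap F E f) = algebraMap F E (dF f))
    (hS : ∀ f, dS (algebraMap F S f) = algebraMap F S (dF f)) :
    E ⊗[F] S →+ E ⊗[F] S :=
  TensorProduct.liftAddHom
    (AddMonoidHom.mk' (fun e => AddMonoidHom.mk' (fun s => dE e ⊗ₜ[F] s + e ⊗ₜ[F] dS s)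
        (fun s t => by simp only [map_add, tmul_add]; abel))
      (fun e e' => by ext s; simp [add_tmul]; abel))
    (fun f e s => by
      have h₁ : dE (f • e) = f • dE e + dF f • e := by
        rw [Algebra.smul_def, Derivation.leibniz, hE, smul_eq_mul, smul_eq_mul, mul_comm e,
          ← Algebra.smul_def, ← Algebra.smul_def]
      have h₂ : dS (f • s) = f • dS s + dF f • s := by
        rw [Algebra.smul_def, Derivation.leibniz, hS, smul_eq_mul, smul_eq_mul, mul_comm s,
          ← Algebra.smul_def, ← Algebra.smul_def]
      simp only [AddMonoidHom.mk'_apply, h₁, h₂, tmul_add, add_tmul, smul_tmul]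
      abel)

open TensorProduct in
/-- The derivation `d₁ ⊗ 1 + 1 ⊗ d₂` on a tensor product of differential algebras over a
differential ring. -/
noncomputable def tensorDerivation {F E S : Type*} [CommRing F] [CommRing E] [CommRing S]
    [Algebra F E] [Algebra F S] (dF : Derivation ℤ F F) (dE : Derivation ℤ E E)
    (dS : Derivation ℤ S S) (hE : ∀ f, dE (algebraMap F E f) = algebraMap F E (dF f))
    (hS : ∀ f, dS (algebraMap F S f) = algebraMap F S (dF f)) :
    Derivation ℤ (E ⊗[F] S) (E ⊗[F] S) :=
  Derivation.mk'
    { tensorDerivationAux dF dE dS hE hS with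
      map_smul' := fun n x => by simp [-zsmul_eq_mul] }
    (fun a b => by
      change tensorDerivationAux dF dE dS hE hS (a * b) =
        a * tensorDerivationAux dF dE dS hE hS b + b * tensorDerivationAux dF dE dS hE hS a
      induction a with
      | zero => simp
      | add x y hx hy => simp only [add_mul, map_add, mul_add, hx, hy]; abel
      | tmul e s =>
        induction b with
        | zero => simp
        | add x y hx hy => simp only [add_mul, map_add, mul_add, hx, hy]; abel
        | tmul e' s' =>
          simp only [Algebra.TensorProduct.tmul_mul_tmul, tensorDerivationAux,
            TensorProduct.liftAddHom_tmul, AddMonoidHom.mk'_apply, Derivation.leibniz,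
            smul_eq_mul, mul_add, add_tmul, tmul_add]
          rw [mul_comm e' e, mul_comm s' s]
          abel)

theorem Derivation.map_matrix_mul {R m : Type*} [CommRing R] [Fintype m] (d : Derivation ℤ R R)
    (M N : Matrix m m R) : (M * N).map d = M.map d * N + M * N.map d := by
  ext i j
  simp only [Matrix.map_apply, Matrix.mul_apply, Matrix.add_apply, map_sum, Derivation.leibniz,
    smul_eq_mul, Finset.sum_add_distrib]
  rw [add_comm]
  simp only [mul_comm]

theorem Derivation.map_matrix_one {R m : Type*} [CommRing R] [DecidableEq m]
    (d : Derivation ℤ R R) : (1 : Matrix m m R).map d = 0 := by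
  ext i j
  by_cases h : i = j <;> simp [h]

/-- If `W` solves `∂W = A W`, then its inverse solves `∂W' = -W' A`. -/
theorem Derivation.map_matrix_inverse {R m : Type*} [CommRing R] [Fintype m] [DecidableEq m]
    (d : Derivation ℤ R R) {A W W' : Matrix m m R} (hWW' : W * W' = 1) (hW'W : W' * W = 1)
    (hW : W.map d = A * W) : W'.map d = -(W' * A) := by
  have h := d.map_matrix_mul W W'
  rw [hWW', d.map_matrix_one, hW, mul_assoc, hWW', mul_one] at h
  calc W'.map d = W' * W * W'.map d := by rw [hW'W, one_mul]
    _ = W' * (A + W * W'.map d) - W' * A := by rw [mul_add, mul_assoc]; abel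
    _ = -(W' * A) := by rw [← h]; simp

/-- The quotient of two fundamental matrices of the same equation is constant. -/
theorem Derivation.map_inverse_mul_eq_zero {R m : Type*} [CommRing R] [Fintype m] [DecidableEq m]
    (d : Derivation ℤ R R) {A W W' V : Matrix m m R} (hWW' : W * W' = 1) (hW'W : W' * W = 1)
    (hW : W.map d = A * W) (hV : V.map d = A * V) : (W' * V).map d = 0 := by
  rw [d.map_matrix_mul, d.map_matrix_inverse hWW' hW'W hW, hV, neg_mul, mul_assoc,
    neg_add_cancel]

/-- A surjective endomorphism of a Noetherian commutative ring is injective. -/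
theorem IsNoetherianRing.ringHom_injective_of_surjective {B : Type*} [CommRing B]
    [IsNoetherianRing B] (e : B →+* B) (he : Function.Surjective e) : Function.Injective e := by
  have hmono : Monotone fun n : ℕ => RingHom.ker (e ^ n) := by
    refine monotone_nat_of_le_succ fun n x hx => ?_
    rw [RingHom.mem_ker] at hx ⊢
    rw [pow_succ', RingHom.mul_def, RingHom.comp_apply, hx, map_zero]
  obtain ⟨n, hn⟩ := monotone_stabilizes_iff_noetherian.mpr ‹IsNoetherianRing B›
    ⟨fun n : ℕ => RingHom.ker (e ^ n), hmono⟩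
  rw [injective_iff_map_eq_zero]
  intro x hx
  have hs : Function.Surjective (e ^ n) := by
    rw [RingHom.coe_pow]
    exact he.iterate n
  obtain ⟨y, rfl⟩ := hs x
  have hy : y ∈ RingHom.ker (e ^ (n + 1)) := by
    rw [RingHom.mem_ker, pow_succ', RingHom.mul_def, RingHom.comp_apply, hx]
  have heq : RingHom.ker (e ^ n) = RingHom.ker (e ^ (n + 1)) := hn (n + 1) n.le_succ
  rw [← heq] at hy
  exact hy

/-- Constants that are linearly independent over the field of constants `K` of `E` remain
linearly independent over `E`. -/
theorem linearIndependent_of_constants {K E T ι : Type*} [Field K] [Field E] [Algebra K E]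
    [CommRing T] [Algebra K T] [Algebra E T] [IsScalarTower K E T]
    (dE : Derivation ℤ E E) (dT : Derivation ℤ T T)
    (hET : ∀ e, dT (algebraMap E T e) = algebraMap E T (dE e))
    (hconst : ∀ e, dE e = 0 → e ∈ Set.range (algebraMap K E))
    {v : ι → T} (hv : ∀ i, dT (v i) = 0) (hli : LinearIndependent K v) :
    LinearIndependent E v := by
  classical
  rw [linearIndependent_iff']
  intro s
  induction s using Finset.strongInduction with
  | H s ih =>
    intro g hg i hi
    by_contra hgi
    set h : ι → E := fun j => (g i)⁻¹ * g j with hdef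
    have hh : ∑ j ∈ s, h j • v j = 0 := by
      simp only [hdef, mul_smul, ← Finset.smul_sum, hg, smul_zero]
    have h1 : h i = 1 := inv_mul_cancel₀ hgi
    have hd : ∑ j ∈ s, dE (h j) • v j = 0 := by
      have := congrArg dT hh
      rw [map_sum, map_zero] at this
      rw [← this]
      refine Finset.sum_congr rfl fun j _ => ?_
      rw [Algebra.smul_def, Algebra.smul_def, dT.leibniz, hv, hET, smul_zero, zero_add,
        smul_eq_mul, mul_comm]
    rw [← Finset.add_sum_erase s _ hi, h1, Derivation.map_one_eq_zero, zero_smul, zero_add] at hd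
    have hz : ∀ j ∈ s, dE (h j) = 0 := by
      intro j hj
      by_cases hji : j = i
      · rw [hji, h1, Derivation.map_one_eq_zero]
      · exact ih _ (Finset.erase_ssubset hi) _ hd j (Finset.mem_erase.mpr ⟨hji, hj⟩)
    choose! c hc using fun j hj => hconst _ (hz j hj)
    have hcs : ∑ j ∈ s, c j • v j = 0 := by
      rw [← hh]
      refine Finset.sum_congr rfl fun j hj => ?_
      rw [← hc j hj, algebraMap_smul]
    have := linearIndependent_iff'.mp hli s c hcs i hi
    rw [← hc i hi, this, map_zero] at h1
    exact zero_ne_one h1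

open TensorProduct in
/-- A `K`-algebra of constants in a differential `E`-algebra is linearly disjoint from `E`. -/
theorem productMap_injective_of_constants {K E T : Type*} [Field K] [Field E] [Algebra K E]
    [CommRing T] [Algebra K T] [Algebra E T] [IsScalarTower K E T]
    (dE : Derivation ℤ E E) (dT : Derivation ℤ T T)
    (hET : ∀ e, dT (algebraMap E T e) = algebraMap E T (dE e))
    (hconst : ∀ e, dE e = 0 → e ∈ Set.range (algebraMap K E))
    (C : Subalgebra K T) (hC : ∀ c ∈ C, dT c = 0) :
    Function.Injective (Algebra.TensorProduct.productMap (IsScalarTower.toAlgHom K E T) C.val) := by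
  set b := Module.Basis.ofVectorSpace K C
  have hli : LinearIndependent E fun i => (b i : T) :=
    linearIndependent_of_constants dE dT hET hconst (fun i => hC _ (b i).2)
      (b.linearIndependent.map' C.val.toLinearMap
        (LinearMap.ker_eq_bot.mpr Subtype.val_injective))
  set B := Algebra.TensorProduct.basis E b
  rw [injective_iff_map_eq_zero]
  intro t ht
  rw [← B.linearCombination_repr t, Finsupp.linearCombination_apply, Finsupp.sum, map_sum] at ht
  have h0 : ∀ i ∈ (B.repr t).support, B.repr t i = 0 := by
    refine linearIndependent_iff'.mp hli _ _ ?_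
    rw [← ht]
    refine Finset.sum_congr rfl fun i _ => ?_
    rw [Algebra.TensorProduct.basis_apply, TensorProduct.smul_tmul', smul_eq_mul, mul_one,
      Algebra.TensorProduct.productMap_apply_tmul, Algebra.smul_def]
    rfl
  have : B.repr t = 0 := by
    ext i
    by_contra hi
    exact hi (h0 i (Finsupp.mem_support_iff.mpr hi))
  simpa using this

open TensorProduct in
/-- Let `R` be a Noetherian `K`-subalgebra of `E`, and let `ψ : R → T` be a homomorphism to a
differential `E`-algebra `T` such that `R` and `ψ(R)` generate the same subalgebra of `T` over a
finitely generated algebra `C` of constants. Then `ψ` is injective. -/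
theorem injective_of_range_sup_constants_eq {K E T R : Type*} [Field K] [Field E] [Algebra K E]
    [CommRing T] [Nontrivial T] [Algebra K T] [Algebra E T] [IsScalarTower K E T]
    [CommRing R] [IsNoetherianRing R] [Algebra K R]
    (dE : Derivation ℤ E E) (dT : Derivation ℤ T T)
    (hET : ∀ e, dT (algebraMap E T e) = algebraMap E T (dE e))
    (hconst : ∀ e, dE e = 0 → e ∈ Set.range (algebraMap K E))
    (C : Subalgebra K T) (hC : ∀ c ∈ C, dT c = 0) (hfg : C.FG)
    (j : R →ₐ[K] E) (hj : Function.Injective j) (ψ : R →ₐ[K] T)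
    (hrange : ((IsScalarTower.toAlgHom K E T).comp j).range ⊔ C = ψ.range ⊔ C) :
    Function.Injective ψ := by
  set φ := (IsScalarTower.toAlgHom K E T).comp j
  set θ : R ⊗[K] C →ₐ[K] T := Algebra.TensorProduct.productMap φ C.val
  set η : R ⊗[K] C →ₐ[K] T := Algebra.TensorProduct.productMap ψ C.val
  have hθ : Function.Injective θ := by
    have hcomp : θ = (Algebra.TensorProduct.productMap (IsScalarTower.toAlgHom K E T) C.val).comp
        (Algebra.TensorProduct.map j (AlgHom.id K C)) := by
      ext <;> simp [θ, φ]
    rw [hcomp]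
    exact (productMap_injective_of_constants dE dT hET hconst C hC).comp
      (Module.Flat.rTensor_preserves_injective_linearMap (M := C) j.toLinearMap hj)
  have hran : θ.range = η.range := by
    simp only [θ, η, Algebra.TensorProduct.productMap_range, Subalgebra.range_val, hrange]
  have : Algebra.FiniteType K C := C.fg_iff_finiteType.mp hfg
  have : IsNoetherianRing (R ⊗[K] C) := Algebra.FiniteType.isNoetherianRing R _
  let eθ := AlgEquiv.ofInjective θ hθ
  let e : R ⊗[K] C →ₐ[K] R ⊗[K] C :=
    eθ.symm.toAlgHom.comp (η.codRestrict θ.range fun x => hran ▸ η.mem_range_self x)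
  have he : ∀ x, θ (e x) = η x := fun x =>
    congrArg Subtype.val (eθ.apply_symm_apply ⟨η x, hran ▸ η.mem_range_self x⟩)
  have hsurj : Function.Surjective e := by
    intro y
    obtain ⟨x, hx⟩ : θ y ∈ η.range := hran ▸ θ.mem_range_self y
    exact ⟨x, hθ ((he x).trans hx)⟩
  have hinj := IsNoetherianRing.ringHom_injective_of_surjective e.toRingHom hsurj
  rw [injective_iff_map_eq_zero]
  intro r hr
  have h0 : e (r ⊗ₜ 1) = 0 := by
    apply hθ
    rw [he, map_zero]
    simp [η, hr]
  have h1 : r ⊗ₜ[K] (1 : C) = 0 := hinj (h0.trans (map_zero e).symm)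
  have h2 : algebraMap E T (j r) = 0 := by
    have := congrArg θ h1
    simpa [θ, φ] using this
  rw [map_eq_zero_iff _ (algebraMap E T).injective] at h2
  exact (map_eq_zero_iff j hj).mp h2

theorem AlgHom.mem_of_adjoin_eq_top {K F R T : Type*} [Field K] [Field F] [CommRing R] [CommRing T]
    [Algebra K T] [Algebra F R] [Algebra F T] (f : R →ₐ[F] T) (D : Subalgebra K T)
    (hF : ∀ c, algebraMap F T c ∈ D) {s : Set R} (hs : Algebra.adjoin F s = ⊤)
    (h : ∀ x ∈ s, f x ∈ D) (x : R) : f x ∈ D := by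
  have hx : x ∈ Algebra.adjoin F s := hs ▸ Algebra.mem_top
  induction hx using Algebra.adjoin_induction with
  | mem x hx => exact h x hx
  | algebraMap c => rw [f.commutes]; exact hF c
  | add x y _ _ hx hy => rw [map_add]; exact D.add_mem hx hy
  | mul x y _ _ hx hy => rw [map_mul]; exact D.mul_mem hx hy

theorem Subalgebra.matrix_mul_mem {K T m : Type*} [CommSemiring K] [CommSemiring T] [Algebra K T]
    [Fintype m] (D : Subalgebra K T) {M N : Matrix m m T} (hM : ∀ i j, M i j ∈ D)
    (hN : ∀ i j, N i j ∈ D) (i j : m) : (M * N) i j ∈ D := by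
  rw [Matrix.mul_apply]
  exact D.sum_mem fun k _ => D.mul_mem (hM i k) (hN k j)

open TensorProduct in
/-- A differential `F`-algebra `R` generated by a fundamental matrix and its inverse, inside a
differential field without new constants, is differentially simple. -/
theorem differentiallySimple_of_fundamentalMatrix {K F E R m : Type*} [Field K] [Field F]
    [Field E] [CommRing R] [Algebra K F] [Algebra F E] [Algebra K E] [IsScalarTower K F E]
    [Algebra F R] [Algebra K R] [IsScalarTower K F R] [Fintype m] [DecidableEq m]
    (dF : Derivation ℤ F F) (dE : Derivation ℤ E E) (dR : Derivation ℤ R R)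
    (hFE : ∀ f, dE (algebraMap F E f) = algebraMap F E (dF f))
    (hFR : ∀ f, dR (algebraMap F R f) = algebraMap F R (dF f))
    (hconst : ∀ e, dE e = 0 ↔ e ∈ Set.range (algebraMap K E))
    (j : R →ₐ[F] E) (hj : Function.Injective j) (hjd : ∀ r, j (dR r) = dE (j r))
    (A : Matrix m m F) {W W' : Matrix m m R} (hWW' : W * W' = 1) (hW'W : W' * W = 1)
    (hW : W.map dR = A.map (algebraMap F R) * W)
    (hgen : Algebra.adjoin F ({x | ∃ i j, W i j = x} ∪ {x | ∃ i j, W' i j = x}) = ⊤)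
    (I : Ideal R) (hI : ∀ x ∈ I, dR x ∈ I) : I = ⊥ ∨ I = ⊤ := by
  refine or_iff_not_imp_right.mpr fun htop => ?_
  have : Nontrivial (R ⧸ I) := Ideal.Quotient.nontrivial_iff.mpr htop
  have : IsNoetherianRing R := by
    have : Algebra.FiniteType F R := by
      refine ⟨Subalgebra.fg_def.mpr ⟨_, ?_, hgen⟩⟩
      refine Set.Finite.union ?_ ?_
      · exact (Set.finite_range fun p : m × m => W p.1 p.2).subset
          (by rintro _ ⟨i, j, rfl⟩; exact ⟨(i, j), rfl⟩)
      · exact (Set.finite_range fun p : m × m => W' p.1 p.2).subset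
          (by rintro _ ⟨i, j, rfl⟩; exact ⟨(i, j), rfl⟩)
    exact Algebra.FiniteType.isNoetherianRing F R
  let q : R →ₐ[F] R ⧸ I := Ideal.Quotient.mkₐ F I
  have hq : Function.Surjective q := Ideal.Quotient.mkₐ_surjective F I
  have hqd : ∀ x, q x = 0 → q (dR x) = 0 := fun x hx =>
    Ideal.Quotient.eq_zero_iff_mem.mpr (hI x (Ideal.Quotient.eq_zero_iff_mem.mp hx))
  let dS : Derivation ℤ (R ⧸ I) (R ⧸ I) :=
    Derivation.liftOfSurjective (f := q.toRingHom.toIntAlgHom) hq hqd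
  have hdS : ∀ r, dS (q r) = q (dR r) :=
    Derivation.liftOfSurjective_apply (f := q.toRingHom.toIntAlgHom) hq hqd
  have hFS : ∀ f, dS (algebraMap F (R ⧸ I) f) = algebraMap F (R ⧸ I) (dF f) := fun f => by
    rw [← q.commutes, hdS, hFR, q.commutes]
  let dT := tensorDerivation dF dE dS hFE hFS
  let ι : E →ₐ[F] E ⊗[F] (R ⧸ I) := Algebra.TensorProduct.includeLeft
  have hι : ∀ e, dT (ι e) = ι (dE e) := fun e => by
    change dE e ⊗ₜ[F] 1 + e ⊗ₜ[F] dS 1 = dE e ⊗ₜ[F] 1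
    simp
  let φ : R →ₐ[F] E ⊗[F] (R ⧸ I) := ι.comp j
  let ψ : R →ₐ[F] E ⊗[F] (R ⧸ I) := Algebra.TensorProduct.includeRight.comp q
  have hφ : ∀ r, dT (φ r) = φ (dR r) := fun r => (hι (j r)).trans (congrArg ι (hjd r).symm)
  have hψ : ∀ r, dT (ψ r) = ψ (dR r) := fun r => by
    change dE 1 ⊗ₜ[F] q r + 1 ⊗ₜ[F] dS (q r) = 1 ⊗ₜ[F] q (dR r)
    simp [hdS]
  have hmat : ∀ f : R →ₐ[F] E ⊗[F] (R ⧸ I), (∀ r, dT (f r) = f (dR r)) →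
      W.map f * W'.map f = 1 ∧ W'.map f * W.map f = 1 ∧
      (W.map f).map dT = A.map (algebraMap F _) * W.map f := by
    intro f hf
    refine ⟨?_, ?_, ?_⟩
    · rw [← Matrix.map_mul, hWW', Matrix.map_one _ (map_zero f) (map_one f)]
    · rw [← Matrix.map_mul, hW'W, Matrix.map_one _ (map_zero f) (map_one f)]
    · have : (W.map f).map dT = (W.map dR).map f := by ext i k; exact hf _
      rw [this, hW, Matrix.map_mul]
      congr 1
      ext i k
      exact f.commutes _
  obtain ⟨hφ₁, hφ₂, hφ₃⟩ := hmat φ hφ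
  obtain ⟨hψ₁, hψ₂, hψ₃⟩ := hmat ψ hψ
  set Z := W'.map φ * W.map ψ with hZ
  set Z' := W'.map ψ * W.map φ with hZ'
  let s : Set (E ⊗[F] (R ⧸ I)) :=
    Set.range (fun p : m × m => Z p.1 p.2) ∪ Set.range (fun p : m × m => Z' p.1 p.2)
  let C : Subalgebra K (E ⊗[F] (R ⧸ I)) := Algebra.adjoin K s
  have hZC : ∀ i k, Z i k ∈ C := fun i k => Algebra.subset_adjoin (Or.inl ⟨(i, k), rfl⟩)
  have hZ'C : ∀ i k, Z' i k ∈ C := fun i k => Algebra.subset_adjoin (Or.inr ⟨(i, k), rfl⟩)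
  have hfg : C.FG :=
    Subalgebra.fg_def.mpr ⟨s, (Set.finite_range _).union (Set.finite_range _), rfl⟩
  have hC : ∀ c ∈ C, dT c = 0 := by
    intro c hc
    induction hc using Algebra.adjoin_induction with
    | mem x hx =>
      rcases hx with ⟨p, rfl⟩ | ⟨p, rfl⟩
      · exact congrFun₂ (dT.map_inverse_mul_eq_zero hφ₁ hφ₂ hφ₃ hψ₃) p.1 p.2
      · exact congrFun₂ (dT.map_inverse_mul_eq_zero hψ₁ hψ₂ hψ₃ hφ₃) p.1 p.2
    | algebraMap c =>
      change dT (ι (algebraMap K E c)) = 0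
      rw [hι, (hconst _).mpr ⟨c, rfl⟩, map_zero]
    | add x y _ _ hx hy => rw [map_add, hx, hy, add_zero]
    | mul x y _ _ hx hy => rw [Derivation.leibniz, hx, hy, smul_zero, smul_zero, add_zero]
  have hle : ∀ f g : R →ₐ[F] E ⊗[F] (R ⧸ I),
      (∀ i k, f (W i k) ∈ (g.restrictScalars K).range ⊔ C) →
      (∀ i k, f (W' i k) ∈ (g.restrictScalars K).range ⊔ C) →
      (f.restrictScalars K).range ⊔ C ≤ (g.restrictScalars K).range ⊔ C := by
    intro f g h h'
    refine sup_le ?_ le_sup_right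
    rintro _ ⟨r, rfl⟩
    refine f.mem_of_adjoin_eq_top _ (fun c => ?_) hgen ?_ r
    · rw [← g.commutes]
      exact le_sup_left (a := (g.restrictScalars K).range) ⟨_, rfl⟩
    · rintro _ (⟨i, k, rfl⟩ | ⟨i, k, rfl⟩)
      exacts [h i k, h' i k]
  have hl : ∀ (g : R →ₐ[F] E ⊗[F] (R ⧸ I)) (M : Matrix m m R) i k,
      M.map g i k ∈ (g.restrictScalars K).range ⊔ C := fun g M i k =>
    le_sup_left (a := (g.restrictScalars K).range) ⟨_, rfl⟩
  have hr : ∀ (g : R →ₐ[F] E ⊗[F] (R ⧸ I)) {M : Matrix m m (E ⊗[F] (R ⧸ I))},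
      (∀ i k, M i k ∈ C) → ∀ i k, M i k ∈ (g.restrictScalars K).range ⊔ C :=
    fun g M hM i k => le_sup_right (a := (g.restrictScalars K).range) (hM i k)
  have hinj : Function.Injective (ψ.restrictScalars K) := by
    refine injective_of_range_sup_constants_eq dE dT hι (fun e => (hconst e).mp) C hC hfg (j.restrictScalars K) hj
      (ψ.restrictScalars K) (le_antisymm (hle φ ψ ?_ ?_) (hle ψ φ ?_ ?_))
    · have h : W.map φ = W.map ψ * Z' := by rw [hZ', ← mul_assoc, hψ₁, one_mul]
      intro i k
      rw [← Matrix.map_apply (f := φ), h]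
      exact Subalgebra.matrix_mul_mem _ (hl ψ W) (hr ψ hZ'C) i k
    · have h : W'.map φ = Z * W'.map ψ := by rw [hZ, mul_assoc, hψ₁, mul_one]
      intro i k
      rw [← Matrix.map_apply (f := φ), h]
      exact Subalgebra.matrix_mul_mem _ (hr ψ hZC) (hl ψ W') i k
    · have h : W.map ψ = W.map φ * Z := by rw [hZ, ← mul_assoc, hφ₁, one_mul]
      intro i k
      rw [← Matrix.map_apply (f := ψ), h]
      exact Subalgebra.matrix_mul_mem _ (hl φ W) (hr φ hZC) i k
    · have h : W'.map ψ = Z' * W'.map φ := by rw [hZ', mul_assoc, hφ₁, mul_one]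
      intro i k
      rw [← Matrix.map_apply (f := ψ), h]
      exact Subalgebra.matrix_mul_mem _ (hr φ hZ'C) (hl φ W') i k
  rw [eq_bot_iff]
  intro x hx
  refine hinj ?_
  rw [map_zero]
  change (1 : E) ⊗ₜ[F] q x = 0
  rw [show q x = 0 from Ideal.Quotient.eq_zero_iff_mem.mpr hx, tmul_zero]

/-- Restriction of a derivation to a subalgebra it preserves. -/
def Derivation.restrictSubalgebra {F E : Type*} [CommRing F] [CommRing E] [Algebra F E]
    (d : Derivation ℤ E E) (R : Subalgebra F E) (h : ∀ x ∈ R, d x ∈ R) : Derivation ℤ R R :=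
  Derivation.mk'
    { toFun := fun x => ⟨d x, h x x.2⟩
      map_add' := fun x y => Subtype.ext (map_add d (x : E) y)
      map_smul' := fun n x => Subtype.ext (by simp) }
    (fun x y => Subtype.ext (d.leibniz (x : E) y))

/-- If `E/F` is a Picard-Vessiot extension generated by the fundamental
solution matrix `W` (with inverse `W'`), then the `F`-subalgebra
`R = F[W_ij, det(W)⁻¹] = F[W_ij, W'_ij]` of `E` is differentially simple, and consequently it
is a Picard-Vessiot ring over `F` for `A` (with respect to the derivation induced from `E`). -/
theorem pvExtension_subalgebra_isPVRing (K F E : Type*) [Field K] [Field F] [CharZero F]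
    [Algebra K F] [Field E] [Algebra F E]
    (dF : Derivation ℤ F F) (dE : Derivation ℤ E E)
    (hK : ∀ f : F, dF f = 0 ↔ f ∈ Set.range (algebraMap K F))
    (hext : ∀ f : F, dE (algebraMap F E f) = algebraMap F E (dF f))
    (hconst : ∀ x : E, dE x = 0 ↔ ∃ c : K, x = algebraMap F E (algebraMap K F c))
    (n : ℕ) (A : Matrix (Fin n) (Fin n) F)
    (W W' : Matrix (Fin n) (Fin n) E) (hWW' : W * W' = 1) (hW'W : W' * W = 1)
    (hW : ∀ i j, dE (W i j) = (A.map (algebraMap F E) * W) i j)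
    (hgen : IntermediateField.adjoin F {x | ∃ i j, W i j = x} = ⊤)
    (R : Subalgebra F E)
    (hRdef : R = Algebra.adjoin F ({x | ∃ i j, W i j = x} ∪ {x | ∃ i j, W' i j = x})) :
    ∃ dR : Derivation ℤ R R, (∀ x : R, (dR x : E) = dE (x : E)) ∧
      (∀ I : Ideal R, (∀ x ∈ I, dR x ∈ I) → I = ⊥ ∨ I = ⊤) ∧
      IsPicardVessiotRing K F R dF dR A := by
  let _ : Algebra K E := ((algebraMap F E).comp (algebraMap K F)).toAlgebra
  have : IsScalarTower K F E := IsScalarTower.of_algebraMap_eq fun _ => rfl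
  have hKE : ∀ x : E, dE x = 0 ↔ x ∈ Set.range (algebraMap K E) := fun x =>
    (hconst x).trans (exists_congr fun _ => eq_comm)
  have hFR : ∀ f, algebraMap F E f ∈ R := R.algebraMap_mem
  have hWR : ∀ i j, W i j ∈ R := fun i j =>
    hRdef ▸ Algebra.subset_adjoin (Or.inl ⟨i, j, rfl⟩)
  have hW'R : ∀ i j, W' i j ∈ R := fun i j =>
    hRdef ▸ Algebra.subset_adjoin (Or.inr ⟨i, j, rfl⟩)
  have hWd : W.map dE = A.map (algebraMap F E) * W := by ext i j; exact hW i j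
  have hstable : ∀ x ∈ R, dE x ∈ R := by
    intro x hx
    rw [hRdef] at hx
    induction hx using Algebra.adjoin_induction with
    | mem x hx =>
      rcases hx with ⟨i, j, rfl⟩ | ⟨i, j, rfl⟩
      · rw [hW]
        exact R.matrix_mul_mem (fun _ _ => hFR _) hWR i j
      · have h := congrFun₂ (dE.map_matrix_inverse hWW' hW'W hWd) i j
        rw [Matrix.map_apply, Matrix.neg_apply] at h
        rw [h]
        exact R.neg_mem (R.matrix_mul_mem hW'R (fun _ _ => hFR _) i j)
    | algebraMap f => rw [hext]; exact hFR _
    | add x y _ _ hx hy => rw [map_add]; exact R.add_mem hx hy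
    | mul x y hx' hy' hx hy =>
      rw [← hRdef] at hx' hy'
      rw [Derivation.leibniz]
      exact R.add_mem (R.mul_mem hx' hy) (R.mul_mem hy' hx)
  let dR := dE.restrictSubalgebra R hstable
  have hdR : ∀ x : R, (dR x : E) = dE (x : E) := fun _ => rfl
  have hextR : ∀ f, dR (algebraMap F R f) = algebraMap F R (dF f) := fun f => Subtype.ext (hext f)
  let w : Matrix (Fin n) (Fin n) R := Matrix.of fun i j => ⟨W i j, hWR i j⟩
  let w' : Matrix (Fin n) (Fin n) R := Matrix.of fun i j => ⟨W' i j, hW'R i j⟩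
  have hinj : Function.Injective fun M : Matrix (Fin n) (Fin n) R => M.map R.val :=
    Matrix.map_injective Subtype.val_injective
  have hw : w.map R.val = W := rfl
  have hw' : w'.map R.val = W' := rfl
  have hone : (1 : Matrix (Fin n) (Fin n) R).map R.val = 1 :=
    Matrix.map_one _ (map_zero _) (map_one _)
  have hww' : w * w' = 1 := hinj (by
    simp only [Matrix.map_mul, hw, hw', hone, hWW'])
  have hw'w : w' * w = 1 := hinj (by
    simp only [Matrix.map_mul, hw, hw', hone, hW'W])
  have hwd : w.map dR = A.map (algebraMap F R) * w := hinj (by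
    simp only [Matrix.map_mul, hw]
    exact hWd)
  have hwgen : Algebra.adjoin F ({x | ∃ i j, w i j = x} ∪ {x | ∃ i j, w' i j = x}) = ⊤ := by
    refine Subalgebra.map_injective (f := R.val) Subtype.val_injective ?_
    rw [AlgHom.map_adjoin, Algebra.map_top, Subalgebra.range_val]
    conv_rhs => rw [hRdef]
    congr 1
    rw [Set.image_union]
    congr 1 <;> ext x <;> simp [w, w', Matrix.of_apply]
  have hsimple : ∀ I : Ideal R, (∀ x ∈ I, dR x ∈ I) → I = ⊥ ∨ I = ⊤ :=
    differentiallySimple_of_fundamentalMatrix dF dE dR hext hextR hKE R.val Subtype.val_injective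
      hdR A hww' hw'w hwd hwgen
  refine ⟨dR, hdR, hsimple, hextR, inferInstance,
    ⟨w, w', hww', hw'w, fun i j => congrFun₂ hwd i j, hwgen⟩, fun x y hy hxy => ?_, hsimple⟩
  have hy' : (y : E) ≠ 0 := fun h => hy (Subtype.ext h)
  have hxy' : dE x * y = x * dE y := congrArg Subtype.val hxy
  have hx : (x : E) = x / y * y := (div_mul_cancel₀ _ hy').symm
  have hz : dE ((x : E) / y) = 0 := by
    have h := congrArg dE hx
    rw [Derivation.leibniz, smul_eq_mul, smul_eq_mul] at h
    have h2 : (y : E) * y * dE ((x : E) / y) = 0 := by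
      linear_combination (-(y : E)) * h + hxy' + dE y * hx
    exact (mul_eq_zero.mp h2).resolve_left (mul_ne_zero hy' hy')
  obtain ⟨c, hc⟩ := (hconst _).mp hz
  exact ⟨c, Subtype.ext (by rw [hx, hc]; rfl)⟩
end

section
/- Let F be a differential field of characteristic zero with field of constants K, and let L/K be an algebraic Galois field extension with Galois group Γ = Gal(L/K), carrying the Krull topology. Assume that F̃ := F ⊗_K L is a field; equip it with the derivation determined by ∂(f ⊗ l) = ∂(f) ⊗ l, so that F̃ is a differential field whose field of constants is K ⊗_K L ≅ L, and Γ acts on F̃ by σ ↦ id ⊗ σ. Let Ẽ be a Picard-Vessiot extension of F̃ for some matrix Ã ∈ Mₙ(F̃), and suppose given an action ρ of Γ on Ẽ by ring automorphisms commuting with the derivation of Ẽ, such that ρ(σ) restricts to id ⊗ σ on F̃ for every σ ∈ Γ, and such that the stabilizer of every element of Ẽ is an open subgroup of Γ. Then the fixed field E = Ẽ^Γ = {x ∈ Ẽ : ρ(σ)(x) = x for all σ}, which contains F = F ⊗ 1, is a Picard-Vessiot extension of F: its field of constants is K, and there exist an integer m, a matrix B ∈ M_m(F), and V ∈ GL_m(E)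 with ∂(V) = BV such that E = F(V_ij). Moreover, the natural map E ⊗_K L → Ẽ is an isomorphism. -/
set_option synthInstance.maxHeartbeats 400000
set_option maxHeartbeats 1000000

/-- A transfer map for a semilinear action `ρ` of `Gal(L/K)` on a field `M`: an additive map `T`,
linear over the fixed field, which maps a subfield `X` containing a prescribed set `S` to the fixed
field, together with dual families `e`, `f` in `L` through which elements of `X` can be
reconstructed from their transfers. -/
structure GaloisTransfer {K L M : Type*} [Field K] [Field L] [Field M] [Algebra K L]
    [Algebra L M] (ρ : (L ≃ₐ[K] L) →* (M ≃+* M)) (S : Set M) where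
  X : Subfield M
  subset : S ⊆ X
  T : M →+ M
  fixed : ∀ x ∈ X, ∀ σ, ρ σ (T x) = T x
  map_mul : ∀ a, (∀ σ, ρ σ a = a) → ∀ x, T (a * x) = a * T x
  map_comm : ∀ D : M →+ M, (∀ σ x, ρ σ (D x) = D (ρ σ x)) → ∀ x, T (D x) = D (T x)
  map_algebraMap : ∀ l : L, ∃ l' : L, T (algebraMap L M l) = algebraMap L M l'
  d : ℕ
  e : Fin d → L
  f : Fin d → L
  e_mem : ∀ q, algebraMap L M (e q) ∈ X
  f_mem : ∀ q, algebraMap L M (f q) ∈ X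
  sum_eq : ∀ x ∈ X, ∑ q, T (x * algebraMap L M (e q)) * algebraMap L M (f q) = x
  dual : ∀ p q, T (algebraMap L M (e p) * algebraMap L M (f q)) = if p = q then 1 else 0
  map_one_ne : T 1 ≠ 0

theorem exists_finite_normal_fixing {K L M : Type*} [Field K] [Field L] [Field M]
    [Algebra K L] [IsGalois K L] (ρ : (L ≃ₐ[K] L) →* (M ≃+* M))
    (hopen : ∀ x : M, IsOpen {σ : L ≃ₐ[K] L | ρ σ x = x}) (S : Set M) (hS : S.Finite) :
    ∃ K' : IntermediateField K L, FiniteDimensional K K' ∧ Normal K K' ∧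
      ∀ x ∈ S, ∀ σ ∈ K'.fixingSubgroup, ρ σ x = x := by
  have h : IsOpen (⋂ x ∈ S, {σ : L ≃ₐ[K] L | ρ σ x = x}) :=
    hS.isOpen_biInter fun x _ => hopen x
  have h1 : (⋂ x ∈ S, {σ : L ≃ₐ[K] L | ρ σ x = x}) ∈ nhds (1 : L ≃ₐ[K] L) :=
    h.mem_nhds (by simp)
  rw [krullTopology_mem_nhds_one_iff_of_normal] at h1
  obtain ⟨K', hfin, hn, hK'⟩ := h1
  refine ⟨K', hfin, hn, fun x hx σ hσ => ?_⟩
  have := hK' hσ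
  simp only [Set.mem_iInter] at this
  exact this x hx

theorem sum_mul_traceDual {K K' ι : Type*} [Field K] [Field K'] [Algebra K K'] [Fintype ι]
    [DecidableEq ι] [FiniteDimensional K K'] [IsGalois K K'] [DecidableEq (K' ≃ₐ[K] K')]
    (b : Module.Basis ι K K')
    (g : K' ≃ₐ[K] K') : ∑ q, g (b q) * b.traceDual q = if g = 1 then 1 else 0 := by
  let P : Matrix ι (K' ≃ₐ[K] K') K' := Matrix.of fun p g => g (b p)
  let N : Matrix (K' ≃ₐ[K] K') ι K' := Matrix.of fun g p => g (b.traceDual p)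
  have h : P * N = 1 := by
    ext p q
    have := congrArg (algebraMap K K') (b.trace_mul_traceDual p q)
    rw [trace_eq_sum_automorphisms] at this
    simp only [Matrix.mul_apply, P, N, Matrix.of_apply, ← map_mul, Matrix.one_apply, this]
    split_ifs <;> simp
  have hc : Fintype.card ι = Fintype.card (K' ≃ₐ[K] K') := by
    rw [← Nat.card_eq_fintype_card (α := K' ≃ₐ[K] K'), IsGalois.card_aut_eq_finrank,
      Module.finrank_eq_card_basis b]
  rw [Matrix.mul_eq_one_comm_of_card_eq _ _ _ hc] at h
  have := congrFun (congrFun h 1) g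
  simp only [Matrix.mul_apply, P, N, Matrix.of_apply, Matrix.one_apply, AlgEquiv.one_apply] at this
  rw [← Finset.sum_congr rfl fun q _ => mul_comm _ _, this]
  simp [eq_comm]

theorem nonempty_galoisTransfer {K L M : Type*} [Field K] [Field L] [Field M] [CharZero K]
    [Algebra K L] [IsGalois K L] [Algebra L M] (ρ : (L ≃ₐ[K] L) →* (M ≃+* M))
    (hρL : ∀ (σ : L ≃ₐ[K] L) (l : L), ρ σ (algebraMap L M l) = algebraMap L M (σ l))
    (hopen : ∀ x : M, IsOpen {σ : L ≃ₐ[K] L | ρ σ x = x}) (S : Set M) (hS : S.Finite) :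
    Nonempty (GaloisTransfer ρ S) := by
  classical
  obtain ⟨K', hfin, hn, hK'⟩ := exists_finite_normal_fixing ρ hopen S hS
  have : IsGalois K K' := { }
  let X : Subfield M :=
    { carrier := {x | ∀ σ ∈ K'.fixingSubgroup, ρ σ x = x}
      mul_mem' := fun {a b} ha hb σ hσ => by rw [map_mul, ha σ hσ, hb σ hσ]
      add_mem' := fun {a b} ha hb σ hσ => by rw [map_add, ha σ hσ, hb σ hσ]
      one_mem' := fun σ hσ => map_one _
      zero_mem' := fun σ hσ => map_zero _
      neg_mem' := fun {a} ha σ hσ => by rw [map_neg, ha σ hσ]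
      inv_mem' := fun a ha σ hσ => by rw [map_inv₀, ha σ hσ] }
  have hX : ∀ x, x ∈ X ↔ ∀ σ ∈ K'.fixingSubgroup, ρ σ x = x := fun x => Iff.rfl
  have hKX : ∀ y : K', algebraMap L M y ∈ X := fun y σ hσ => by
    rw [hρL, (IntermediateField.mem_fixingSubgroup_iff _ _).1 hσ y y.2]
  let s : (K' ≃ₐ[K] K') → (L ≃ₐ[K] L) := fun g => g.liftNormal L
  have hs : ∀ g (y : K'), s g y = g y := fun g y => g.liftNormal_commutes L y
  have heq : ∀ x ∈ X, ∀ σ τ : L ≃ₐ[K] L, (∀ y : K', σ y = τ y) → ρ σ x = ρ τ x := by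
    intro x hx σ τ h
    have h1 : τ⁻¹ * σ ∈ K'.fixingSubgroup := by
      rw [IntermediateField.mem_fixingSubgroup_iff]
      intro y hy
      rw [AlgEquiv.mul_apply, h ⟨y, hy⟩, ← AlgEquiv.mul_apply]
      simp
    have h2 := congrArg (ρ τ) (hx _ h1)
    rw [← RingAut.mul_apply, ← map_mul] at h2
    simpa using h2
  let T : M →+ M := ∑ g : K' ≃ₐ[K] K', (ρ (s g) : M →+* M).toAddMonoidHom
  have hT : ∀ x, T x = ∑ g : K' ≃ₐ[K] K', ρ (s g) x := fun x => by
    simp [T]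
  have hfix : ∀ x ∈ X, ∀ σ, ρ σ (T x) = T x := by
    intro x hx σ
    rw [hT, map_sum]
    refine Fintype.sum_equiv (Equiv.mulLeft (AlgEquiv.restrictNormalHom K' σ)) _ _ fun g => ?_
    rw [← RingAut.mul_apply, ← map_mul]
    refine heq x hx _ _ fun y => ?_
    rw [AlgEquiv.mul_apply, hs, hs]
    exact (AlgEquiv.restrictNormal_commutes σ K' (g y)).symm
  let φ : K' →+* M := (algebraMap L M).comp (algebraMap K' L)
  let b := Module.finBasis K K'
  refine ⟨{ X := X, subset := fun x hx => hK' x hx, T := T,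
            fixed := hfix, map_mul := ?_, map_comm := ?_, map_algebraMap := ?_,
            d := _,
            e := fun q => b q, f := fun q => b.traceDual q, e_mem := fun q => hKX _,
            f_mem := fun q => hKX _, sum_eq := ?_, dual := ?_, map_one_ne := ?_ }⟩
  · intro a ha x
    simp [hT, ha, Finset.mul_sum]
  · intro D hD x
    simp [hT, hD]
  · intro l
    exact ⟨∑ g, s g l, by simp [hT, hρL]⟩
  · intro x hx
    have h1 : ∀ g : K' ≃ₐ[K] K', ∑ q, algebraMap L M (g (b q) : K') *
        algebraMap L M (b.traceDual q : K') = if g = 1 then 1 else 0 := by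
      intro g
      have := congrArg φ (sum_mul_traceDual b g)
      rw [map_sum, apply_ite φ, map_one, map_zero] at this
      simpa only [map_mul] using! this
    calc _ = ∑ g : K' ≃ₐ[K] K', ρ (s g) x * ∑ q, algebraMap L M (g (b q) : K') *
        algebraMap L M (b.traceDual q : K') := by
          simp only [hT, map_mul, hρL, hs, Finset.sum_mul, Finset.mul_sum]
          rw [Finset.sum_comm]
          simp only [mul_assoc]
      _ = ρ (s 1) x := by simp [h1]
      _ = ρ 1 x := heq x hx _ _ fun y => by rw [hs]; rfl
      _ = x := by simp
  · intro p q
    rw [hT]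
    have h1 := congrArg (algebraMap K K') (b.trace_mul_traceDual p q)
    rw [trace_eq_sum_automorphisms] at h1
    have h2 := congrArg φ h1
    simp only [map_mul, hρL, hs]
    rw [apply_ite (algebraMap K K'), map_one, map_zero, apply_ite φ, map_one, map_zero,
      map_sum] at h2
    simpa only [map_mul] using! h2
  · have : CharZero L := charZero_of_injective_algebraMap (algebraMap K L).injective
    have : CharZero M := charZero_of_injective_algebraMap (algebraMap L M).injective
    simp [hT]

namespace GaloisTransfer

variable {K L M : Type*} [Field K] [Field L] [Field M] [Algebra K L] [Algebra L M]
  {ρ : (L ≃ₐ[K] L) →* (M ≃+* M)} {S : Set M}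

theorem sum_map_mul_map (t : GaloisTransfer ρ S) {x : M} (hx : x ∈ t.X) (y : M) :
    ∑ q, t.T (x * algebraMap L M (t.e q)) * t.T (algebraMap L M (t.f q) * y) = t.T (x * y) := by
  conv_rhs => rw [← t.sum_eq x hx, Finset.sum_mul, map_sum]
  refine Finset.sum_congr rfl fun q _ => ?_
  rw [mul_assoc _ _ y, t.map_mul (t.T _)]
  exact t.fixed _ (mul_mem hx (t.e_mem q))

theorem map_mem_span (t : GaloisTransfer ρ S) (E' : Subfield M)
    (hfix : ∀ a ∈ E', ∀ σ, ρ σ a = a) {x : M}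
    (hx : x ∈ Submodule.span E' (Set.range (algebraMap L M))) :
    t.T x ∈ Submodule.span E' (Set.range (algebraMap L M)) := by
  induction hx using Submodule.span_induction with
  | mem x h =>
    obtain ⟨l, rfl⟩ := h
    obtain ⟨l', h⟩ := t.map_algebraMap l
    rw [h]
    exact Submodule.subset_span ⟨l', rfl⟩
  | zero => simp
  | add x y _ _ hx hy => rw [map_add]; exact add_mem hx hy
  | smul a x _ hx =>
    rw [Subfield.smul_def, smul_eq_mul, t.map_mul _ (hfix a a.2)]
    exact Submodule.smul_mem _ a hx

theorem exists_map_algebraMap_eq [IsGalois K L] [Algebra K M] [IsScalarTower K L M]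
    (hρL : ∀ (σ : L ≃ₐ[K] L) (l : L), ρ σ (algebraMap L M l) = algebraMap L M (σ l))
    (t : GaloisTransfer ρ S) {l : L} (hl : algebraMap L M l ∈ t.X) :
    ∃ c : K, t.T (algebraMap L M l) = algebraMap K M c := by
  obtain ⟨l', h⟩ := t.map_algebraMap l
  have h1 : l' ∈ Set.range (algebraMap K L) := by
    rw [InfiniteGalois.mem_range_algebraMap_iff_fixed]
    intro σ
    apply (algebraMap L M).injective
    rw [← hρL, ← h, t.fixed _ hl]
  obtain ⟨c, rfl⟩ := h1
  exact ⟨c, by rw [h, ← IsScalarTower.algebraMap_apply]⟩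

/-- The matrix of transfers `T (N i j * a p * b q)`, with rows `(i, p)` and columns `(j, q)`. -/
def matrix (t : GaloisTransfer ρ S) {n : ℕ} (N : Matrix (Fin n) (Fin n) M) (a b : Fin t.d → L) :
    Matrix (Fin n × Fin t.d) (Fin n × Fin t.d) M :=
  Matrix.of fun u v => t.T (N u.1 v.1 * algebraMap L M (a u.2) * algebraMap L M (b v.2))

variable {n : ℕ}

theorem matrix_mul (t : GaloisTransfer ρ S) (N N' : Matrix (Fin n) (Fin n) M)
    (hN : ∀ i j, N i j ∈ t.X) (a b : Fin t.d → L) (ha : ∀ q, algebraMap L M (a q) ∈ t.X) :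
    t.matrix N a t.e * t.matrix N' t.f b = t.matrix (N * N') a b := by
  ext ⟨i, p⟩ ⟨k, r⟩
  simp only [matrix, Matrix.mul_apply, Matrix.of_apply, Fintype.sum_prod_type, Finset.sum_mul,
    map_sum]
  refine Finset.sum_congr rfl fun j _ => ?_
  have h := t.sum_map_mul_map (mul_mem (hN i j) (ha p)) (N' j k * algebraMap L M (b r))
  calc _ = _ := Finset.sum_congr rfl fun q _ => by congr 2; ring
    _ = _ := h
    _ = _ := by congr 1; ring

theorem matrix_mul' (t : GaloisTransfer ρ S) (N N' : Matrix (Fin n) (Fin n) M)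
    (hN' : ∀ i j, N' i j ∈ t.X) (a b : Fin t.d → L) (hb : ∀ q, algebraMap L M (b q) ∈ t.X) :
    t.matrix N a t.f * t.matrix N' t.e b = t.matrix (N * N') a b := by
  ext ⟨i, p⟩ ⟨k, r⟩
  simp only [matrix, Matrix.mul_apply, Matrix.of_apply, Fintype.sum_prod_type, Finset.sum_mul,
    map_sum]
  refine Finset.sum_congr rfl fun j _ => ?_
  have h := t.sum_map_mul_map (mul_mem (hN' j k) (hb r)) (N i j * algebraMap L M (a p))
  calc _ = _ := Finset.sum_congr rfl fun q _ => by rw [mul_comm]; congr 2 <;> ring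
    _ = _ := h
    _ = _ := by congr 1; ring

theorem matrix_one (t : GaloisTransfer ρ S) :
    t.matrix (1 : Matrix (Fin n) (Fin n) M) t.e t.f = 1 := by
  ext ⟨i, p⟩ ⟨k, r⟩
  by_cases h : i = k <;> simp [matrix, Matrix.one_apply, h, t.dual]

end GaloisTransfer

theorem mem_of_mem_span_of_fixed {K L M : Type*} [Field K] [Field L] [Field M] [CharZero K]
    [Algebra K L] [IsGalois K L] [Algebra L M] [Algebra K M] [IsScalarTower K L M]
    (ρ : (L ≃ₐ[K] L) →* (M ≃+* M))
    (hρL : ∀ (σ : L ≃ₐ[K] L) (l : L), ρ σ (algebraMap L M l) = algebraMap L M (σ l))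
    (hopen : ∀ x : M, IsOpen {σ : L ≃ₐ[K] L | ρ σ x = x})
    (E' : Subfield M) (hfix : ∀ a ∈ E', ∀ σ, ρ σ a = a)
    (hK : ∀ c : K, algebraMap K M c ∈ E') {y : M} (hy : ∀ σ, ρ σ y = y)
    (hspan : y ∈ Submodule.span E' (Set.range (algebraMap L M))) : y ∈ E' := by
  obtain ⟨c, rfl⟩ := Finsupp.mem_span_range_iff_exists_finsupp.1 hspan
  obtain ⟨t⟩ := nonempty_galoisTransfer ρ hρL hopen (algebraMap L M '' c.support)
    (c.support.finite_toSet.image _)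
  set y := c.sum fun i a => a • algebraMap L M i with hydef
  have h1 : t.T y ∈ E' := by
    rw [hydef, Finsupp.sum, map_sum]
    refine sum_mem fun l hl => ?_
    rw [Subfield.smul_def, smul_eq_mul, t.map_mul _ (hfix _ (c l).2)]
    obtain ⟨k, hk⟩ := t.exists_map_algebraMap_eq hρL (t.subset ⟨l, hl, rfl⟩)
    exact mul_mem (c l).2 (hk ▸ hK k)
  have h2 : t.T 1 ∈ E' := by
    obtain ⟨k, hk⟩ := t.exists_map_algebraMap_eq hρL (l := 1) (by simp)
    rw [map_one] at hk
    exact hk ▸ hK k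
  have h3 : y = t.T y / t.T 1 := by
    rw [eq_div_iff t.map_one_ne, ← t.map_mul y hy, mul_one]
  rw [h3]
  exact div_mem h1 h2

open TensorProduct in
theorem bijective_productMap_fixed {K L M : Type*} [Field K] [Field L] [Field M] [CharZero K]
    [Algebra K L] [IsGalois K L] [Algebra L M] [Algebra K M] [IsScalarTower K L M]
    (ρ : (L ≃ₐ[K] L) →* (M ≃+* M))
    (hρL : ∀ (σ : L ≃ₐ[K] L) (l : L), ρ σ (algebraMap L M l) = algebraMap L M (σ l))
    (hopen : ∀ x : M, IsOpen {σ : L ≃ₐ[K] L | ρ σ x = x})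
    (E : Subfield M)
    (hE : (E : Set M) = {x : M | ∀ σ : L ≃ₐ[K] L, ρ σ x = x})
    [Algebra K ↥E] [IsScalarTower K ↥E M] :
    Function.Bijective (Algebra.TensorProduct.productMap
      (IsScalarTower.toAlgHom K ↥E M) (IsScalarTower.toAlgHom K L M)) := by
  have hmem : ∀ x, x ∈ E ↔ ∀ σ : L ≃ₐ[K] L, ρ σ x = x := fun x => by
    rw [← SetLike.mem_coe, hE]; rfl
  constructor
  · rw [injective_iff_map_eq_zero]
    intro z hz
    obtain ⟨s, rfl⟩ := TensorProduct.exists_finset z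
    obtain ⟨t⟩ := nonempty_galoisTransfer ρ hρL hopen
      ((fun i => algebraMap L M i.2) '' (s : Set (E × L)))
      (s.finite_toSet.image _)
    have hX : ∀ i ∈ s, algebraMap L M i.2 ∈ t.X := fun i hi => t.subset ⟨i, hi, rfl⟩
    have hc : ∀ i : E × L, ∀ q, ∃ c : K, i ∈ s →
        t.T (algebraMap L M (i.2 * t.e q)) = algebraMap K M c := by
      intro i q
      by_cases hi : i ∈ s
      · obtain ⟨c, hc⟩ := t.exists_map_algebraMap_eq hρL (l := i.2 * t.e q)
          (by rw [map_mul]; exact mul_mem (hX i hi) (t.e_mem q))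
        exact ⟨c, fun _ => hc⟩
      · exact ⟨0, fun h => absurd h hi⟩
    choose c hc using hc
    have hl : ∀ i ∈ s, i.2 = ∑ q, c i q • t.f q := by
      intro i hi
      apply (algebraMap L M).injective
      rw [← t.sum_eq _ (hX i hi), map_sum]
      refine Finset.sum_congr rfl fun q _ => ?_
      rw [← map_mul, hc i q hi, Algebra.smul_def, map_mul, ← IsScalarTower.algebraMap_apply]
    have hz' : ∑ i ∈ s, (i.1 : M) * algebraMap L M i.2 = 0 := by
      simpa [map_sum] using! hz
    have h0 : ∀ q, ∑ i ∈ s, c i q • i.1 = 0 := by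
      intro q
      apply (algebraMap E M).injective
      have := congrArg (fun x => t.T (x * algebraMap L M (t.e q))) hz'
      simp only [zero_mul, map_zero, Finset.sum_mul, map_sum, mul_assoc] at this
      rw [map_zero, map_sum, ← this]
      refine Finset.sum_congr rfl fun i hi => ?_
      rw [t.map_mul _ ((hmem _).1 i.1.2), ← map_mul, hc i q hi, Algebra.smul_def, map_mul,
        ← IsScalarTower.algebraMap_apply, mul_comm]
      rfl
    calc ∑ i ∈ s, i.1 ⊗ₜ[K] i.2 = ∑ i ∈ s, ∑ q, (c i q • i.1) ⊗ₜ[K] t.f q := by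
          refine Finset.sum_congr rfl fun i hi => ?_
          conv_lhs => rw [hl i hi, TensorProduct.tmul_sum]
          simp only [TensorProduct.tmul_smul, TensorProduct.smul_tmul']
      _ = ∑ q, (∑ i ∈ s, c i q • i.1) ⊗ₜ[K] t.f q := by
          rw [Finset.sum_comm]
          simp only [TensorProduct.sum_tmul]
      _ = 0 := by simp [h0]
  · intro x
    obtain ⟨t⟩ := nonempty_galoisTransfer ρ hρL hopen {x} (Set.finite_singleton x)
    have hx : x ∈ t.X := t.subset rfl
    refine ⟨∑ q, (⟨t.T (x * algebraMap L M (t.e q)),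
      (hmem _).2 (t.fixed _ (mul_mem hx (t.e_mem q)))⟩ : E) ⊗ₜ t.f q, ?_⟩
    conv_rhs => rw [← t.sum_eq x hx]
    simp only [map_sum, Algebra.TensorProduct.productMap_apply_tmul,
      IsScalarTower.coe_toAlgHom']
    rfl

theorem mem_span_of_adjoin_eq_top {K L M : Type*} [Field K] [Field L] [Field M]
    [Algebra K L] [Algebra.IsAlgebraic K L] [Algebra L M] [Algebra K M] [IsScalarTower K L M]
    (E' : Subfield M) (hK : ∀ c : K, algebraMap K M c ∈ E')
    (h : IntermediateField.adjoin E' (Set.range (algebraMap L M)) = ⊤) (y : M) :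
    y ∈ Submodule.span E' (Set.range (algebraMap L M)) := by
  have halg : ∀ x ∈ Set.range (algebraMap L M), IsAlgebraic E' x := by
    rintro _ ⟨l, rfl⟩
    let φ : K →+* E' := (algebraMap K M).codRestrict E' hK
    let _ : Algebra K E' := φ.toAlgebra
    have : IsScalarTower K E' M := IsScalarTower.of_algebraMap_eq' rfl
    exact ((Algebra.IsAlgebraic.isAlgebraic (R := K) l).algebraMap (A := M)).tower_top E'
  have h1 := IntermediateField.adjoin_toSubalgebra_of_isAlgebraic halg
  have h2 : y ∈ Algebra.adjoin E' (Set.range (algebraMap L M)) := by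
    rw [← h1, h]; trivial
  rw [← Subalgebra.mem_toSubmodule, Algebra.adjoin_eq_span] at h2
  have h3 : Submonoid.closure (Set.range (algebraMap L M)) =
      MonoidHom.mrange (algebraMap L M : L →* M) := by
    rw [← Submonoid.closure_eq (MonoidHom.mrange (algebraMap L M : L →* M))]
    rfl
  rw [h3] at h2
  exact h2

open TensorProduct in
/-- Galois descent for Picard-Vessiot extensions. Let `F` be a differential
field of characteristic zero with field of constants `K`, let `L/K` be an (algebraic) Galois
extension with Galois group `Γ = Gal(L/K)` (with the Krull topology), and let `Ft = F ⊗_K L`,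
assumed to be a field, with the derivation `∂(f ⊗ l) = ∂f ⊗ l` and field of constants `L`.
Let `Et` be a Picard-Vessiot extension of `Ft` for a matrix `At ∈ Mₙ(Ft)` and let `ρ` be an
action of `Γ` on `Et` by differential ring automorphisms which restricts on `Ft` to
`σ ↦ id ⊗ σ` and has open stabilizers. Then the fixed field `E = Et^Γ` contains `F`, its
field of constants is `K`, it is a Picard-Vessiot extension of `F` (generated over `F` by a
fundamental solution matrix `V ∈ GL_m(E)` of some equation given by `B ∈ M_m(F)`), and the
natural map `E ⊗_K L → Et` is an isomorphism. -/
theorem galois_descent_pv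
    (K F L Ft Et : Type*) [Field K] [Field F] [Field L] [Field Ft] [Field Et]
    [CharZero K] [Algebra K F] [Algebra K L] [IsGalois K L]
    -- `Ft` is the field `F ⊗_K L`:
    [Algebra K Ft] [Algebra F Ft] [Algebra L Ft] [IsScalarTower K F Ft] [IsScalarTower K L Ft]
    (htensor : Function.Bijective (Algebra.TensorProduct.productMap
      (IsScalarTower.toAlgHom K F Ft) (IsScalarTower.toAlgHom K L Ft)))
    -- derivations and constants:
    (dF : Derivation ℤ F F) (hKconst : ∀ x : F, dF x = 0 ↔ x ∈ Set.range (algebraMap K F))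
    (dFt : Derivation ℤ Ft Ft)
    (hFt1 : ∀ f : F, dFt (algebraMap F Ft f) = algebraMap F Ft (dF f))
    (hFt2 : ∀ l : L, dFt (algebraMap L Ft l) = 0)
    (hFtconst : ∀ x : Ft, dFt x = 0 ↔ x ∈ Set.range (algebraMap L Ft))
    -- `Et` is a Picard-Vessiot extension of `Ft`:
    [Algebra Ft Et] [Algebra F Et] [Algebra L Et] [Algebra K Et]
    [IsScalarTower F Ft Et] [IsScalarTower L Ft Et] [IsScalarTower K F Et]
    [IsScalarTower K L Et]
    (dEt : Derivation ℤ Et Et)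
    (n : ℕ) (At : Matrix (Fin n) (Fin n) Ft)
    (hPV : IsPicardVessiotExtension L Ft Et dFt dEt At)
    -- the semilinear Galois action on `Et`:
    (ρ : (L ≃ₐ[K] L) →* (Et ≃+* Et))
    (hρd : ∀ (σ : L ≃ₐ[K] L) (x : Et), ρ σ (dEt x) = dEt (ρ σ x))
    (hρF : ∀ (σ : L ≃ₐ[K] L) (f : F), ρ σ (algebraMap F Et f) = algebraMap F Et f)
    (hρL : ∀ (σ : L ≃ₐ[K] L) (l : L), ρ σ (algebraMap L Et l) = algebraMap L Et (σ l))
    (hopen : ∀ x : Et, IsOpen {σ : L ≃ₐ[K] L | ρ σ x = x})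
    -- the fixed field `E = Et^Γ`:
    (E : Subfield Et) (hE : (E : Set Et) = {x : Et | ∀ σ : L ≃ₐ[K] L, ρ σ x = x})
    [Algebra K ↥E] [IsScalarTower K ↥E Et] :
    -- `E` contains `F ⊗ 1`:
    (∀ f : F, algebraMap F Et f ∈ E) ∧
    -- the field of constants of `E` is `K`:
    (∀ x : Et, x ∈ E → (dEt x = 0 ↔ ∃ c : K, x = algebraMap K Et c)) ∧
    -- `E` is a Picard-Vessiot extension of `F`:
    (∃ (m : ℕ) (B : Matrix (Fin m) (Fin m) F) (V V' : Matrix (Fin m) (Fin m) Et),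
      V * V' = 1 ∧ V' * V = 1 ∧
      (∀ i j, V i j ∈ E) ∧ (∀ i j, V' i j ∈ E) ∧
      (∀ i j, dEt (V i j) = (B.map (algebraMap F Et) * V) i j) ∧
      Subfield.closure (Set.range (algebraMap F Et) ∪ {x | ∃ i j, V i j = x}) = E) ∧
    -- the natural map `E ⊗_K L → Et` is an isomorphism:
    Function.Bijective (Algebra.TensorProduct.productMap
      (IsScalarTower.toAlgHom K ↥E Et) (IsScalarTower.toAlgHom K L Et)) := by
  obtain ⟨-, ⟨W, W', hWW', -, hdW, hadj⟩, hconst⟩ := hPV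
  have : IsScalarTower K Ft Et := by
    refine IsScalarTower.of_algebraMap_eq fun x => ?_
    rw [IsScalarTower.algebraMap_apply K F Ft, ← IsScalarTower.algebraMap_apply F Ft Et,
      ← IsScalarTower.algebraMap_apply K F Et]
  have hmem : ∀ x, x ∈ E ↔ ∀ σ : L ≃ₐ[K] L, ρ σ x = x := fun x => by
    rw [← SetLike.mem_coe, hE]; rfl
  have hFE : ∀ f : F, algebraMap F Et f ∈ E := fun f => (hmem _).2 fun σ => hρF σ f
  have hdL : ∀ l : L, dEt (algebraMap L Et l) = 0 := fun l =>
    (hconst _).2 ⟨l, by rw [← IsScalarTower.algebraMap_apply]⟩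
  refine ⟨hFE, fun x hx => ⟨fun h0 => ?_, ?_⟩, ?_, bijective_productMap_fixed ρ hρL hopen E hE⟩
  · obtain ⟨l, rfl⟩ := (hconst x).1 h0
    rw [← IsScalarTower.algebraMap_apply] at hx ⊢
    have h1 : l ∈ Set.range (algebraMap K L) := by
      rw [InfiniteGalois.mem_range_algebraMap_iff_fixed]
      intro σ
      apply (algebraMap L Et).injective
      rw [← hρL, (hmem _).1 hx]
    obtain ⟨c, rfl⟩ := h1
    exact ⟨c, by rw [← IsScalarTower.algebraMap_apply]⟩
  · rintro ⟨c, rfl⟩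
    rw [IsScalarTower.algebraMap_apply K L Et]
    exact hdL _
  set A := At.map (algebraMap Ft Et) with hA
  obtain ⟨t⟩ := nonempty_galoisTransfer ρ hρL hopen
    (Set.range (fun u : Fin n × Fin n => W u.1 u.2) ∪
      Set.range (fun u : Fin n × Fin n => W' u.1 u.2) ∪
      Set.range (fun u : Fin n × Fin n => A u.1 u.2))
    (((Set.finite_range _).union (Set.finite_range _)).union (Set.finite_range _))
  have hWX : ∀ i j, W i j ∈ t.X := fun i j => t.subset (.inl (.inl ⟨(i, j), rfl⟩))
  have hW'X : ∀ i j, W' i j ∈ t.X := fun i j => t.subset (.inl (.inr ⟨(i, j), rfl⟩))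
  have hAX : ∀ i j, A i j ∈ t.X := fun i j => t.subset (.inr ⟨(i, j), rfl⟩)
  have hinE : ∀ x ∈ t.X, t.T x ∈ E := fun x hx => (hmem _).2 (t.fixed x hx)
  let F' : Subfield Et := (algebraMap F Et).fieldRange
  have hF'fix : ∀ a ∈ F', ∀ σ, ρ σ a = a := by
    rintro _ ⟨f, rfl⟩ σ
    exact hρF σ f
  have hKF' : ∀ c : K, algebraMap K Et c ∈ F' := fun c =>
    ⟨algebraMap K F c, by rw [← IsScalarTower.algebraMap_apply]⟩
  have hFtspan : ∀ x : Ft,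
      algebraMap Ft Et x ∈ Submodule.span F' (Set.range (algebraMap L Et)) := by
    intro x
    obtain ⟨z, rfl⟩ := htensor.2 x
    induction z using TensorProduct.induction_on with
    | zero => simp
    | add z w hz hw => rw [map_add, map_add]; exact add_mem hz hw
    | tmul f l =>
      have h1 := Submodule.smul_mem (Submodule.span F' (Set.range (algebraMap L Et)))
        (⟨algebraMap F Et f, ⟨f, rfl⟩⟩ : F') (Submodule.subset_span ⟨l, rfl⟩)
      rw [Subfield.smul_def, smul_eq_mul] at h1
      simpa [← IsScalarTower.algebraMap_apply] using h1
  have hB : ∀ u v, ∃ b : F, t.matrix A t.e t.f u v = algebraMap F Et b := by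
    intro u v
    have h1 : t.matrix A t.e t.f u v ∈ F' := by
      refine mem_of_mem_span_of_fixed ρ hρL hopen F' hF'fix hKF'
        (t.fixed _ (mul_mem (mul_mem (hAX _ _) (t.e_mem _)) (t.f_mem _)))
        (t.map_mem_span F' hF'fix ?_)
      have h2 := hFtspan (At u.1 v.1 * algebraMap L Ft (t.e u.2) * algebraMap L Ft (t.f v.2))
      simpa only [map_mul, ← IsScalarTower.algebraMap_apply] using! h2
    obtain ⟨b, hb⟩ := h1
    exact ⟨b, hb.symm⟩
  choose B hB using hB
  have hV : t.matrix W t.e t.e * t.matrix W' t.f t.f = 1 := by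
    rw [t.matrix_mul W W' hWX _ _ t.e_mem, hWW', t.matrix_one]
  have hV'E : ∀ i j, t.matrix W' t.f t.f i j ∈ E := by
    intro i j
    exact hinE _ (mul_mem (mul_mem (hW'X _ _) (t.f_mem _)) (t.f_mem _))
  have hdV : ∀ u v, dEt (t.matrix W t.e t.e u v) =
      (t.matrix A t.e t.f * t.matrix W t.e t.e) u v := by
    intro u v
    rw [t.matrix_mul' A W hWX _ _ t.e_mem]
    simp only [GaloisTransfer.matrix, Matrix.of_apply]
    rw [← hdW]
    have h1 := t.map_comm dEt.toLinearMap.toAddMonoidHom (fun σ x => hρd σ x)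
      (W u.1 v.1 * algebraMap L Et (t.e u.2) * algebraMap L Et (t.e v.2))
    refine Eq.trans h1.symm ?_
    congr 1
    change dEt _ = _
    simp only [Derivation.leibniz, hdL, smul_eq_mul]
    ring
  let φ : Fin n × Fin t.d ≃ Fin (n * t.d) := finProdFinEquiv
  refine ⟨n * t.d, Matrix.reindex φ φ (Matrix.of B), Matrix.reindex φ φ (t.matrix W t.e t.e),
    Matrix.reindex φ φ (t.matrix W' t.f t.f), ?_, ?_, ?_, ?_, ?_, ?_⟩
  · simp [Matrix.submatrix_mul_equiv, hV]
  · simp [Matrix.submatrix_mul_equiv, mul_eq_one_comm.1 hV]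
  · intro i j
    exact hinE _ (mul_mem (mul_mem (hWX _ _) (t.e_mem _)) (t.e_mem _))
  · intro i j
    exact hV'E _ _
  · intro i j
    have h1 : (Matrix.reindex φ φ (Matrix.of B)).map (algebraMap F Et) =
        Matrix.reindex φ φ (t.matrix A t.e t.f) := by
      ext i j
      simp [hB]
    rw [h1]
    simp only [Matrix.reindex_apply, Matrix.submatrix_mul_equiv, Matrix.submatrix_apply]
    exact hdV _ _
  · set E' := Subfield.closure (Set.range (algebraMap F Et) ∪
      {x | ∃ i j, Matrix.reindex φ φ (t.matrix W t.e t.e) i j = x}) with hE'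
    have hle : E' ≤ E := by
      rw [hE', Subfield.closure_le]
      rintro _ (⟨f, rfl⟩ | ⟨i, j, rfl⟩)
      · exact hFE f
      · exact hinE _ (mul_mem (mul_mem (hWX _ _) (t.e_mem _)) (t.e_mem _))
    have hFE' : F' ≤ E' := by
      rintro _ ⟨f, rfl⟩
      exact Subfield.subset_closure (.inl ⟨f, rfl⟩)
    have hVE' : ∀ u v, t.matrix W t.e t.e u v ∈ E' := fun u v =>
      Subfield.subset_closure (.inr ⟨φ u, φ v, by simp⟩)
    let N := IntermediateField.adjoin E' (Set.range (algebraMap L Et))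
    have hLN : ∀ l, algebraMap L Et l ∈ N := fun l =>
      IntermediateField.subset_adjoin _ _ ⟨l, rfl⟩
    have hE'N : ∀ x ∈ E', x ∈ N := fun x hx => N.algebraMap_mem ⟨x, hx⟩
    have hFtN : ∀ x : Ft, algebraMap Ft Et x ∈ N := by
      intro x
      have hx := hFtspan x
      generalize algebraMap Ft Et x = z at hx
      induction hx using Submodule.span_induction with
      | mem x h => obtain ⟨l, rfl⟩ := h; exact hLN l
      | zero => exact zero_mem _
      | add x y _ _ hx hy => exact add_mem hx hy
      | smul a x _ hx => exact mul_mem (hE'N _ (hFE' a.2)) hx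
    have hWN : ∀ i j, W i j ∈ N := by
      intro i j
      have h1 : ∃ p, t.e p ≠ 0 := by
        by_contra! h
        simpa [h] using t.sum_eq 1 (one_mem _)
      obtain ⟨p, hp⟩ := h1
      have h2 : W i j * algebraMap L Et (t.e p) ∈ N := by
        rw [← t.sum_eq _ (mul_mem (hWX i j) (t.e_mem p))]
        exact sum_mem fun q _ => mul_mem (hE'N _ (hVE' (i, p) (j, q))) (hLN _)
      have h3 := div_mem h2 (hLN (t.e p))
      rwa [mul_div_cancel_right₀ _ (by simpa using hp)] at h3
    have hN : N = ⊤ := by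
      rw [eq_top_iff]
      intro x _
      have hx : x ∈ IntermediateField.adjoin Ft {x | ∃ i j, W i j = x} := by
        rw [hadj]; trivial
      induction hx using IntermediateField.adjoin_induction with
      | mem x hx => obtain ⟨i, j, rfl⟩ := hx; exact hWN i j
      | algebraMap x => exact hFtN x
      | add x y _ _ hx hy => exact add_mem (hx trivial) (hy trivial)
      | inv x _ hx => exact inv_mem (hx trivial)
      | mul x y _ _ hx hy => exact mul_mem (hx trivial) (hy trivial)
    refine le_antisymm hle fun y hy => ?_
    exact mem_of_mem_span_of_fixed ρ hρL hopen E' (fun a ha => (hmem a).1 (hle ha))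
      (fun c => hFE' (hKF' c)) ((hmem y).1 hy)
      (mem_span_of_adjoin_eq_top E' (fun c => hFE' (hKF' c)) hN y)
end

section
/- Let ℂ(z) denote the field of rational functions over ℂ with the derivation d/dz (the unique derivation with ∂(z) = 1 vanishing on ℂ), and let τ : ℂ(z) → ℂ(z) be the ring automorphism applying complex conjugation to all coefficients (so τ(z) = z, τ commutes with d/dz). Let A ∈ Mₙ(ℂ(z)) and assume the equation ∂y = Ay is equivalent to its conjugate ∂y = τ(A)y, i.e. there exists C ∈ GLₙ(ℂ(z)) with C⁻¹AC − C⁻¹∂(C) = τ(A), where τ(A) and ∂(C) are applied entrywise. Then there exists a Picard-Vessiot extension Ẽ of ℂ(z) for A together with a ring automorphism σ of Ẽ such that: σ commutes with the derivation of Ẽ; σ∘σ = id; σ restricts to τ on ℂ(z); and the fixed field E = {x ∈ Ẽ : σ(x) = x}, regarded as a differential field extension of ℝ(z) (the fixed field of τ in ℂ(z)), is a Picard-Vessiot extension of ℝ(z): its field of constants is ℝ, and there exist an integer m, a matrix B ∈ M_m(ℝ(z)), and V ∈ GL_m(E) with ∂(V) = BV such that E = ℝ(z)(V_ij). -/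
/-- A derivation on the commutative ring `A` (i.e. an additive map satisfying the Leibniz
rule; every such map is automatically `ℤ`-linear). The `ℤ`-algebra instance is pinned to avoid
typeclass diamonds on concrete rings. -/
abbrev Der (A : Type*) [CommRing A] : Type _ :=
  @Derivation ℤ A A _ _ _ (Ring.toIntAlgebra A) _ _

/-- The data witnessing the conclusion of Statement 14: a Picard-Vessiot extension
`Et` of `ℂ(z)` for `A`, together with an involutive differential automorphism `σ` of `Et`
extending the coefficientwise complex conjugation `τ` of `ℂ(z)`, whose fixed field `E` is a
Picard-Vessiot extension of `ℝ(z)` (the fixed field of `τ`): the field of constants of `E` is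
`ℝ` and `E` is generated over `ℝ(z)` by a fundamental solution matrix `V ∈ GL_m(E)` of an
equation with matrix `B ∈ M_m(ℝ(z))`. -/
structure DescendedPicardVessiotData (dC : Der (RatFunc ℂ))
    (τ : RatFunc ℂ ≃+* RatFunc ℂ) {n : ℕ} (A : Matrix (Fin n) (Fin n) (RatFunc ℂ)) where
  Et : Type
  [field : Field Et]
  [alg : Algebra (RatFunc ℂ) Et]
  dE : Derivation ℤ Et Et
  /-- `Et` is a Picard-Vessiot extension of `ℂ(z)` for `A` (with constants `ℂ`). -/
  isPV : IsPicardVessiotExtension ℂ (RatFunc ℂ) Et dC dE A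
  σ : Et ≃+* Et
  /-- `σ` commutes with the derivation. -/
  comm_deriv : ∀ x : Et, σ (dE x) = dE (σ x)
  /-- `σ` is an involution. -/
  invol : ∀ x : Et, σ (σ x) = x
  /-- `σ` restricts to `τ` on `ℂ(z)`. -/
  restricts : ∀ f : RatFunc ℂ,
    σ (algebraMap (RatFunc ℂ) Et f) = algebraMap (RatFunc ℂ) Et (τ f)
  /-- the fixed field of `σ`. -/
  E : Subfield Et
  fixed : (E : Set Et) = {x : Et | σ x = x}
  /-- the field of constants of `E` is `ℝ`. -/
  constants_real : ∀ x : Et, x ∈ E → dE x = 0 →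
    ∃ r : ℝ, x = algebraMap (RatFunc ℂ) Et (RatFunc.C (r : ℂ))
  /-- `E` is a Picard-Vessiot extension of `ℝ(z)`, the fixed field of `τ` in `ℂ(z)`. -/
  pv_real : ∃ (m : ℕ) (B : Matrix (Fin m) (Fin m) (RatFunc ℂ))
      (V V' : Matrix (Fin m) (Fin m) Et),
    (∀ i j, τ (B i j) = B i j) ∧
    V * V' = 1 ∧ V' * V = 1 ∧
    (∀ i j, V i j ∈ E) ∧ (∀ i j, V' i j ∈ E) ∧
    (∀ i j, dE (V i j) = (B.map (algebraMap (RatFunc ℂ) Et) * V) i j) ∧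
    Subfield.closure ({x : Et | ∃ f : RatFunc ℂ, τ f = f ∧ algebraMap (RatFunc ℂ) Et f = x}
      ∪ {x : Et | ∃ i j, V i j = x}) = E

/-- An additive map satisfying the Leibniz rule, as a derivation. -/
def derOfLeibniz {R : Type*} [CommRing R] (d : R →+ R)
    (hd : ∀ x y, d (x * y) = x * d y + y * d x) : Der R :=
  letI : Algebra ℤ R := Ring.toIntAlgebra R
  Derivation.mk' d.toIntLinearMap hd

namespace LaurentSeries

variable {R : Type*} [CommRing R]

/-- The Euler operator `X * d/dX` on Laurent series. -/
def euler (f : LaurentSeries R) : LaurentSeries R where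
  coeff n := n * f.coeff n
  isPWO_support' := f.isPWO_support'.mono fun n hn h => hn (by simp [h])

theorem support_euler_subset (f : LaurentSeries R) : (euler f).support ⊆ f.support :=
  fun n hn h => hn (by simp [euler, h])

theorem euler_mul (f g : LaurentSeries R) :
    euler (f * g) = f * euler g + g * euler f := by
  rw [mul_comm g]
  ext n
  rw [HahnSeries.coeff_add, HahnSeries.coeff_mul_left' f.isPWO_support (support_euler_subset f),
    HahnSeries.coeff_mul_right' g.isPWO_support (support_euler_subset g)]
  simp only [euler, HahnSeries.coeff_mul, Finset.mul_sum, ← Finset.sum_add_distrib]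
  refine Finset.sum_congr rfl fun p hp => ?_
  rw [← (Finset.mem_antidiagonal.1 hp).2.2]
  push_cast
  ring

/-- Differentiation of Laurent series, as a derivation. -/
noncomputable def der (R : Type*) [CommRing R] : Der (LaurentSeries R) :=
  derOfLeibniz
    { toFun f := HahnSeries.single (-1) 1 * euler f
      map_zero' := by
        rw [show euler (0 : LaurentSeries R) = 0 by ext; simp [euler], mul_zero]
      map_add' f g := by
        rw [← mul_add]
        congr 1
        ext
        simp [euler, mul_add] }
    fun f g => by
      simp only [AddMonoidHom.coe_mk, ZeroHom.coe_mk, euler_mul]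
      ring

theorem coeff_der (f : LaurentSeries R) (n : ℤ) :
    (der R f).coeff n = (n + 1) * f.coeff (n + 1) := by
  change (HahnSeries.single (-1) 1 * euler f).coeff n = _
  have := HahnSeries.coeff_single_mul_add (r := (1 : R)) (x := euler f) (a := n + 1) (b := -1)
  rw [add_neg_cancel_right, one_mul] at this
  rw [this]
  simp [euler]

theorem der_coe (g : PowerSeries R) :
    der R (HahnSeries.ofPowerSeries ℤ R g) =
      HahnSeries.ofPowerSeries ℤ R (PowerSeries.derivative R g) := by
  ext n
  rw [coeff_der]
  obtain ⟨k, rfl | rfl⟩ := n.eq_nat_or_neg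
  · rw [HahnSeries.ofPowerSeries_apply_coeff, PowerSeries.coeff_derivative,
      show (k : ℤ) + 1 = ((k + 1 : ℕ) : ℤ) by simp, HahnSeries.ofPowerSeries_apply_coeff]
    push_cast
    ring
  · obtain _ | _ | k := k
    · have := HahnSeries.ofPowerSeries_apply_coeff (Γ := ℤ) g 1
      have h0 := HahnSeries.ofPowerSeries_apply_coeff (Γ := ℤ) (PowerSeries.derivative R g) 0
      simp only [Nat.cast_zero, Nat.cast_one] at this h0
      simp [this, h0, PowerSeries.coeff_derivative]
    · have := PowerSeries.coeff_coe (PowerSeries.derivative R g) (-1)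
      simp [this]
    · have h1 := PowerSeries.coeff_coe (PowerSeries.derivative R g) (-((k + 1 + 1 : ℕ) : ℤ))
      have h2 := PowerSeries.coeff_coe g (-((k + 1 + 1 : ℕ) : ℤ) + 1)
      rw [if_pos (by omega)] at h1 h2
      rw [h1, h2, mul_zero]

theorem eq_C_of_der_eq_zero {K : Type*} [Field K] [CharZero K] {f : LaurentSeries K}
    (hf : der K f = 0) : f = HahnSeries.C (f.coeff 0) := by
  ext n
  have h := coeff_der f (n - 1)
  rw [hf, sub_add_cancel] at h
  rcases eq_or_ne n 0 with rfl | hn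
  · simp
  · have : (n : K) * f.coeff n = 0 := by simpa using h.symm
    simp [HahnSeries.coeff_single_of_ne hn,
      (mul_eq_zero.1 this).resolve_left (by exact_mod_cast hn)]

/-- The automorphism of the ring of Laurent series induced by an automorphism of the
coefficients. -/
def mapEquiv (e : R ≃+* R) : LaurentSeries R ≃+* LaurentSeries R where
  toFun f := f.map e
  invFun f := f.map e.symm
  left_inv f := by ext; simp
  right_inv f := by ext; simp
  map_mul' f g := HahnSeries.map_mul (e : R →ₙ+* R)
  map_add' f g := by ext; simp

theorem coeff_mapEquiv (e : R ≃+* R) (f : LaurentSeries R) (n : ℤ) :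
    (mapEquiv e f).coeff n = e (f.coeff n) := rfl

theorem mapEquiv_der (e : R ≃+* R) (f : LaurentSeries R) :
    mapEquiv e (der R f) = der R (mapEquiv e f) := by
  ext n
  simp [coeff_mapEquiv, coeff_der]

end LaurentSeries

namespace PowerSeries

variable {K : Type*} [Field K] {n : Type*} [Fintype n] [DecidableEq n]

/-- The coefficients of the solution with value `1` at `0` of the linear differential system
whose matrix has coefficients `a`. -/
noncomputable def solutionCoeff (a : ℕ → Matrix n n K) : ℕ → Matrix n n K
  | 0 => 1
  | k + 1 => ((k : K) + 1)⁻¹ • ∑ i : Fin (k + 1), a (k - i) * solutionCoeff a i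

theorem exists_fundamental_matrix [CharZero K] (A : Matrix n n K⟦X⟧) :
    ∃ W W' : Matrix n n K⟦X⟧, W * W' = 1 ∧ W' * W = 1 ∧
      W.map (derivative K) = A * W := by
  let a : ℕ → Matrix n n K := fun k => A.map (coeff k)
  let W : Matrix n n K⟦X⟧ := fun i j => mk fun k => solutionCoeff a k i j
  have hW : W.map (derivative K) = A * W := by
    ext i j k
    have h : solutionCoeff a (k + 1) =
        ((k : K) + 1)⁻¹ • ∑ l : Fin (k + 1), a (k - l) * solutionCoeff a l := by
      rw [solutionCoeff]
    have hk : (k : K) + 1 ≠ 0 := by exact_mod_cast k.succ_ne_zero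
    have hsum : ∑ l : Fin (k + 1), a (k - l) * solutionCoeff a l =
        ∑ l ∈ Finset.range (k + 1), a (k - l) * solutionCoeff a l :=
      Fin.sum_univ_eq_sum_range (fun l => a (k - l) * solutionCoeff a l) (k + 1)
    rw [Matrix.map_apply, coeff_derivative, coeff_mk, h, hsum, Matrix.smul_apply, smul_eq_mul,
      mul_right_comm, inv_mul_cancel₀ hk, one_mul, Matrix.mul_apply, map_sum, Matrix.sum_apply,
      ← Finset.sum_range_reflect]
    simp only [Matrix.mul_apply]
    rw [Finset.sum_comm]
    refine Finset.sum_congr rfl fun m _ => ?_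
    rw [coeff_mul, Finset.Nat.sum_antidiagonal_eq_sum_range_succ_mk]
    refine Finset.sum_congr rfl fun l hl => ?_
    have : l ≤ k := Nat.lt_succ_iff.1 (Finset.mem_range.1 hl)
    simp [a, W, show k - (k - l) = l by omega]
  have hu : IsUnit W.det := by
    rw [isUnit_iff_constantCoeff, RingHom.map_det]
    have : (constantCoeff (R := K)).mapMatrix W = 1 := by
      ext i j
      change constantCoeff (mk fun k => solutionCoeff a k i j) = (1 : Matrix n n K) i j
      rw [← coeff_zero_eq_constantCoeff_apply, coeff_mk, solutionCoeff]
    rw [this, Matrix.det_one]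
    exact isUnit_one
  exact ⟨W, W⁻¹, W.mul_nonsing_inv hu, W.nonsing_inv_mul hu, hW⟩

end PowerSeries

namespace RatFunc

variable {K : Type*} [Field K]

theorem subfield_eq_top {S : Subfield (RatFunc K)} (hC : ∀ c, C c ∈ S) (hX : X ∈ S) :
    S = ⊤ := by
  have hp : ∀ p : Polynomial K, algebraMap _ (RatFunc K) p ∈ S := fun p => by
    induction p using Polynomial.induction_on with
    | C a => simpa using hC a
    | add p q hp hq => simpa using S.add_mem hp hq
    | monomial k a _ => simpa using S.mul_mem (hC a) (S.pow_mem hX (k + 1))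
  refine eq_top_iff.2 fun f _ => ?_
  rw [← num_div_denom f]
  exact S.div_mem (hp _) (hp _)

theorem ringHom_ext {L : Type*} [Field L] {φ ψ : RatFunc K →+* L}
    (hC : ∀ c, φ (C c) = ψ (C c)) (hX : φ X = ψ X) : φ = ψ := by
  have : φ.eqLocusField ψ = ⊤ := subfield_eq_top hC hX
  exact RingHom.ext fun f => (this ▸ Subfield.mem_top f : f ∈ φ.eqLocusField ψ)

/-- Laurent expansion of rational functions at the point `a`. -/
noncomputable def laurentExpansion (a : K) : RatFunc K →+* LaurentSeries K :=
  liftRingHom ((HahnSeries.ofPowerSeries ℤ K).comp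
      (Polynomial.coeToPowerSeries.ringHom.comp (Polynomial.taylorAlgHom a : _ →+* _)))
    (nonZeroDivisors_le_comap_nonZeroDivisors_of_injective _
      (HahnSeries.ofPowerSeries_injective.comp
        ((Polynomial.coe_injective K).comp (Polynomial.taylor_injective a))))

theorem laurentExpansion_algebraMap (a : K) (p : Polynomial K) :
    laurentExpansion a (algebraMap _ _ p) =
      HahnSeries.ofPowerSeries ℤ K (Polynomial.taylor a p : Polynomial K) :=
  liftRingHom_algebraMap _ _ p

theorem laurentExpansion_C (a c : K) : laurentExpansion a (C c) = HahnSeries.C c := by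
  rw [← algebraMap_C, laurentExpansion_algebraMap]
  simp

theorem laurentExpansion_X (a : K) :
    laurentExpansion a X = HahnSeries.ofPowerSeries ℤ K (PowerSeries.X + PowerSeries.C a) := by
  rw [← algebraMap_X, laurentExpansion_algebraMap]
  simp

theorem exists_laurentExpansion_eq_coe {a : K} {f : RatFunc K} (hf : f.denom.eval a ≠ 0) :
    ∃ g : PowerSeries K, laurentExpansion a f = HahnSeries.ofPowerSeries ℤ K g := by
  have hu : PowerSeries.constantCoeff 
      ((Polynomial.taylor a f.denom : Polynomial K) : PowerSeries K) ≠ 0 := by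
    simpa [Polynomial.taylor_coeff_zero] using hf
  refine ⟨(Polynomial.taylor a f.num : Polynomial K) *
    ((Polynomial.taylor a f.denom : Polynomial K) : PowerSeries K)⁻¹, ?_⟩
  conv_lhs => rw [← num_div_denom f]
  rw [map_div₀, laurentExpansion_algebraMap, laurentExpansion_algebraMap, div_eq_iff, ← map_mul,
    mul_assoc, PowerSeries.inv_mul_cancel _ hu, mul_one]
  intro h
  rw [← map_zero (HahnSeries.ofPowerSeries ℤ K)] at h
  rw [HahnSeries.ofPowerSeries_injective h, map_zero] at hu
  exact hu rfl

theorem exists_real_forall_denom_eval_ne_zero {ι : Type*} [Finite ι] (f : ι → RatFunc ℂ) :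
    ∃ r : ℝ, ∀ i, (f i).denom.eval (r : ℂ) ≠ 0 := by
  have hfin : (⋃ i, {r : ℝ | (f i).denom.IsRoot (r : ℂ)}).Finite :=
    Set.finite_iUnion fun i =>
      (Polynomial.finite_setOfPred_isRoot (f i).denom_ne_zero).preimage
        Complex.ofReal_injective.injOn
  obtain ⟨r, hr⟩ := hfin.exists_notMem
  exact ⟨r, fun i hi => hr (Set.mem_iUnion.2 ⟨i, hi⟩)⟩

end RatFunc

/-- The subfield of the elements at which the derivations of the source and the target of a field
homomorphism agree. -/
def Der.eqLocus {F L : Type*} [Field F] [Field L] (dF : Der F) (dL : Der L) (φ : F →+* L) :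
    Subfield F where
  carrier := {x | dL (φ x) = φ (dF x)}
  one_mem' := by simp
  zero_mem' := by simp
  mul_mem' {x y} hx hy := by
    simp only [Set.mem_ofPred_eq] at *
    simp [hx, hy]
  add_mem' {x y} hx hy := by
    simp only [Set.mem_ofPred_eq] at *
    simp [hx, hy]
  neg_mem' {x} hx := by
    simp only [Set.mem_ofPred_eq] at *
    simp [hx]
  inv_mem' x hx := by
    simp only [Set.mem_ofPred_eq] at *
    simp [Derivation.leibniz_inv, hx]

theorem Der.map_mul_matrix {R : Type*} [CommRing R] (d : Der R) {m : Type*} [Fintype m]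
    (M N : Matrix m m R) : (M * N).map d = M.map d * N + M * N.map d := by
  ext i j
  simp [Matrix.mul_apply, ← Finset.sum_add_distrib, mul_comm, add_comm]

/-- `σ` is an involution of the field `T` of characteristic different from two which maps the
square root `j` of `-1` to `-j`. -/
structure IsConjugation {T : Type*} [Field T] (σ : T ≃+* T) (j : T) : Prop where
  invol : ∀ x, σ (σ x) = x
  mul_self : j * j = -1
  apply_root : σ j = -j
  two_ne_zero : (2 : T) ≠ 0

section Conjugation

variable {T : Type*} [Field T]

/-- The real part with respect to an involution `σ`. -/
def rePart (σ : T ≃+* T) : T →+ T :=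
  (AddMonoidHom.mulLeft (2⁻¹ : T)).comp (AddMonoidHom.id T + (σ : T →+ T))

/-- The imaginary part with respect to an involution `σ` and a square root `j` of `-1`. -/
def imPart (σ : T ≃+* T) (j : T) : T →+ T :=
  (AddMonoidHom.mulLeft (2⁻¹ * -j : T)).comp (AddMonoidHom.id T - (σ : T →+ T))

theorem rePart_apply (σ : T ≃+* T) (x : T) : rePart σ x = 2⁻¹ * (x + σ x) := rfl

theorem imPart_apply (σ : T ≃+* T) (j x : T) : imPart σ j x = 2⁻¹ * -j * (x - σ x) := rfl

theorem rePart_inv (σ : T ≃+* T) (x : T) : rePart σ x⁻¹ = rePart σ x / (x * σ x) := by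
  rcases eq_or_ne x 0 with rfl | hx
  · simp
  have hx' : σ x ≠ 0 := by simpa using hx
  simp only [rePart_apply, map_inv₀]
  field_simp
  ring

theorem imPart_inv (σ : T ≃+* T) (j x : T) : imPart σ j x⁻¹ = -imPart σ j x / (x * σ x) := by
  rcases eq_or_ne x 0 with rfl | hx
  · simp
  have hx' : σ x ≠ 0 := by simpa using hx
  simp only [imPart_apply, map_inv₀]
  field_simp
  ring

theorem Der.map_inv_two (d : Der T) : d (2⁻¹ : T) = 0 := by
  rw [Derivation.leibniz_inv, show (2 : T) = ((2 : ℕ) : T) by simp, Derivation.map_natCast,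
    smul_zero]

theorem map_rePart {σ : T ≃+* T} {d : Der T} (hd : ∀ x, σ (d x) = d (σ x)) (x : T) :
    d (rePart σ x) = rePart σ (d x) := by
  simp [rePart_apply, hd, d.map_inv_two]

theorem map_imPart {σ : T ≃+* T} {j : T} {d : Der T} (hd : ∀ x, σ (d x) = d (σ x))
    (hj : d j = 0) (x : T) :
    d (imPart σ j x) = imPart σ j (d x) := by
  simp [imPart_apply, hd, d.map_inv_two, hj]

/-- The real form of a matrix, acting on the direct sum of the real and the imaginary part of a
vector. -/
def realForm (σ : T ≃+* T) (j : T) {n : Type*} (M : Matrix n n T) : Matrix (n ⊕ n) (n ⊕ n) T :=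
  Matrix.fromBlocks (M.map (rePart σ)) (-M.map (imPart σ j)) (M.map (imPart σ j))
    (M.map (rePart σ))

theorem map_realForm {σ : T ≃+* T} {j : T} {n : Type*} {d : Der T}
    (hd : ∀ x, σ (d x) = d (σ x)) (hj : d j = 0)
    (M : Matrix n n T) : (realForm σ j M).map d = realForm σ j (M.map d) := by
  ext a b
  rcases a with a | a <;> rcases b with b | b <;>
    simp [realForm, map_rePart hd, map_imPart hd hj]

namespace IsConjugation

variable {σ : T ≃+* T} {j : T}

theorem apply_rePart (h : IsConjugation σ j) (x : T) : σ (rePart σ x) = rePart σ x := by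
  simp only [rePart_apply, map_mul, map_inv₀, map_ofNat, map_add, h.invol, add_comm]

theorem apply_imPart (h : IsConjugation σ j) (x : T) : σ (imPart σ j x) = imPart σ j x := by
  simp only [imPart_apply, map_mul, map_inv₀, map_ofNat, map_neg, map_sub, h.invol, h.apply_root]
  ring

theorem rePart_mul (h : IsConjugation σ j) (x y : T) :
    rePart σ (x * y) = rePart σ x * rePart σ y - imPart σ j x * imPart σ j y := by
  have h2 := h.two_ne_zero
  simp only [rePart_apply, imPart_apply, map_mul]
  field_simp
  linear_combination (-(x - σ x) * (y - σ y)) * (-h.mul_self)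

theorem imPart_mul (h : IsConjugation σ j) (x y : T) :
    imPart σ j (x * y) = rePart σ x * imPart σ j y + imPart σ j x * rePart σ y := by
  have h2 := h.two_ne_zero
  simp only [rePart_apply, imPart_apply, map_mul]
  field_simp
  ring

theorem rePart_of_apply_eq (h : IsConjugation σ j) {x : T} (hx : σ x = x) : rePart σ x = x := by
  have h2 := h.two_ne_zero
  rw [rePart_apply, hx]
  field_simp
  ring

theorem mul_apply_eq (h : IsConjugation σ j) (x : T) :
    x * σ x = rePart σ x * rePart σ x + imPart σ j x * imPart σ j x := by
  have h2 := h.two_ne_zero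
  simp only [rePart_apply, imPart_apply]
  field_simp
  linear_combination (-(x - σ x) ^ 2) * h.mul_self

/-- The field of all elements whose real and imaginary parts lie in a given subfield. -/
def complexify (h : IsConjugation σ j) (S : Subfield T) : Subfield T where
  carrier := {x | rePart σ x ∈ S ∧ imPart σ j x ∈ S}
  one_mem' := ⟨by rw [h.rePart_of_apply_eq (map_one σ)]; exact S.one_mem, by simp [imPart_apply]⟩
  zero_mem' := by simp
  mul_mem' {x y} hx hy := by
    rw [Set.mem_ofPred_eq, h.rePart_mul, h.imPart_mul]
    exact ⟨S.sub_mem (S.mul_mem hx.1 hy.1) (S.mul_mem hx.2 hy.2),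
      S.add_mem (S.mul_mem hx.1 hy.2) (S.mul_mem hx.2 hy.1)⟩
  add_mem' {x y} hx hy := by
    rw [Set.mem_ofPred_eq, map_add, map_add]
    exact ⟨S.add_mem hx.1 hy.1, S.add_mem hx.2 hy.2⟩
  neg_mem' {x} hx := by
    rw [Set.mem_ofPred_eq, map_neg, map_neg]
    exact ⟨S.neg_mem hx.1, S.neg_mem hx.2⟩
  inv_mem' x hx := by
    have hN : x * σ x ∈ S := by
      rw [h.mul_apply_eq]
      exact S.add_mem (S.mul_mem hx.1 hx.1) (S.mul_mem hx.2 hx.2)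
    rw [Set.mem_ofPred_eq, rePart_inv, imPart_inv]
    exact ⟨S.div_mem hx.1 hN, S.div_mem (S.neg_mem hx.2) hN⟩

theorem mem_complexify (h : IsConjugation σ j) {S : Subfield T} {x : T} :
    x ∈ h.complexify S ↔ rePart σ x ∈ S ∧ imPart σ j x ∈ S := Iff.rfl

variable {n : Type*}

theorem apply_realForm (h : IsConjugation σ j) (M : Matrix n n T) (a b : n ⊕ n) :
    σ (realForm σ j M a b) = realForm σ j M a b := by
  rcases a with a | a <;> rcases b with b | b <;>
    simp [realForm, h.apply_rePart, h.apply_imPart]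

theorem realForm_one (h : IsConjugation σ j) [DecidableEq n] :
    realForm σ j (1 : Matrix n n T) = 1 := by
  have h1 : rePart σ 1 = 1 := h.rePart_of_apply_eq (map_one σ)
  have h2 : imPart σ j 1 = 0 := by simp [imPart_apply]
  ext a b
  rcases a with a | a <;> rcases b with b | b <;>
    simp [realForm, Matrix.one_apply, apply_ite, h1, h2]

theorem realForm_mul (h : IsConjugation σ j) [Fintype n] (M N : Matrix n n T) :
    realForm σ j (M * N) = realForm σ j M * realForm σ j N := by
  have hre : (M * N).map (rePart σ) =
      M.map (rePart σ) * N.map (rePart σ) - M.map (imPart σ j) * N.map (imPart σ j) := by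
    ext a b
    simp [Matrix.mul_apply, h.rePart_mul]
  have him : (M * N).map (imPart σ j) =
      M.map (rePart σ) * N.map (imPart σ j) + M.map (imPart σ j) * N.map (rePart σ) := by
    ext a b
    simp [Matrix.mul_apply, h.imPart_mul, Finset.sum_add_distrib]
  rw [realForm, realForm, realForm, Matrix.fromBlocks_multiply, hre, him]
  congr 1 <;> simp [sub_eq_add_neg, add_comm]

end IsConjugation

end Conjugation

section Map

variable {F T : Type*} [Field F] [Field T] {τ : F ≃+* F} {σ : T ≃+* T} {φ : F →+* T}

theorem rePart_map (hφ : ∀ f, σ (φ f) = φ (τ f)) (f : F) : rePart σ (φ f) = φ (rePart τ f) := by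
  simp only [rePart_apply, hφ, map_mul, map_inv₀, map_ofNat, map_add]

theorem imPart_map (hφ : ∀ f, σ (φ f) = φ (τ f)) (i f : F) :
    imPart σ (φ i) (φ f) = φ (imPart τ i f) := by
  simp only [imPart_apply, hφ, map_mul, map_inv₀, map_ofNat, map_neg, map_sub]

theorem realForm_map (hφ : ∀ f, σ (φ f) = φ (τ f)) (i : F) {n : Type*} (M : Matrix n n F) :
    realForm σ (φ i) (M.map φ) = (realForm τ i M).map φ := by
  ext a b
  rcases a with a | a <;> rcases b with b | b <;>
    simp [realForm, rePart_map hφ, imPart_map hφ]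

end Map

theorem IsPicardVessiotExtension.descend {dC : Der (RatFunc ℂ)}
    {τ : RatFunc ℂ ≃+* RatFunc ℂ} (hτC : ∀ c : ℂ, τ (RatFunc.C c) = RatFunc.C (starRingEnd ℂ c))
    (hτ : ∀ f, τ (τ f) = f) {n : ℕ} {A : Matrix (Fin n) (Fin n) (RatFunc ℂ)}
    {T : Type} [Field T] [Algebra (RatFunc ℂ) T] {d : Der T}
    (hPV : IsPicardVessiotExtension ℂ (RatFunc ℂ) T dC d A) (σ : T ≃+* T)
    (hd : ∀ x, σ (d x) = d (σ x)) (hσ : ∀ x, σ (σ x) = x)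
    (hστ : ∀ f : RatFunc ℂ,
      σ (algebraMap (RatFunc ℂ) T f) = algebraMap (RatFunc ℂ) T (τ f)) :
    Nonempty (DescendedPicardVessiotData dC τ A) := by
  have hconst : ∀ x, d x = 0 → ∃ c : ℂ, x = algebraMap (RatFunc ℂ) T (RatFunc.C c) :=
      fun x hx => by
    obtain ⟨c, hc⟩ := (hPV.constants x).1 hx
    exact ⟨c, by rw [hc, RatFunc.algebraMap_eq_C]⟩
  obtain ⟨W, W', hWW', hW'W, hW, htop⟩ := hPV.exists_fundamental
  set φ : RatFunc ℂ →+* T := algebraMap (RatFunc ℂ) T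
  let I : RatFunc ℂ := RatFunc.C Complex.I
  have hI : IsConjugation τ I :=
    ⟨hτ, by rw [← map_mul, Complex.I_mul_I, map_neg, map_one],
      by rw [hτC, Complex.conj_I, map_neg], two_ne_zero⟩
  have hj : IsConjugation σ (φ I) :=
    ⟨hσ, by rw [← map_mul, hI.mul_self, map_neg, map_one],
      by rw [hστ, hI.apply_root, map_neg], by
        rw [← map_ofNat φ 2]
        exact (map_ne_zero φ).2 two_ne_zero⟩
  have hdj : d (φ I) = 0 :=
    (hPV.constants _).2 ⟨Complex.I, by rw [RatFunc.algebraMap_eq_C]⟩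
  let e := finSumFinEquiv (m := n) (n := n)
  let V := (realForm σ (φ I) W).submatrix e.symm e.symm
  let E : Subfield T := (σ : T →+* T).eqLocusField (RingHom.id T)
  have hE : ∀ x, x ∈ E ↔ σ x = x := fun x => Iff.rfl
  let E₀ : Subfield T := Subfield.closure ({x | ∃ f : RatFunc ℂ, τ f = f ∧ φ f = x}
      ∪ {x | ∃ i j, V i j = x})
  have hφE₀ : ∀ f, τ f = f → φ f ∈ E₀ := fun f hf => Subfield.subset_closure (.inl ⟨f, hf, rfl⟩)
  have hVE₀ : ∀ i j, realForm σ (φ I) W i j ∈ E₀ := fun i j =>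
    Subfield.subset_closure (.inr ⟨e i, e j, by simp [V]⟩)
  have hφmem : ∀ f, φ f ∈ hj.complexify E₀ := fun f => by
    rw [hj.mem_complexify, rePart_map hστ, imPart_map hστ]
    exact ⟨hφE₀ _ (hI.apply_rePart f), hφE₀ _ (hI.apply_imPart f)⟩
  have hWmem : IntermediateField.adjoin (RatFunc ℂ) {x | ∃ i j, W i j = x} ≤
      (hj.complexify E₀).toIntermediateField hφmem := by
    rw [IntermediateField.adjoin_le_iff]
    rintro _ ⟨i, j, rfl⟩
    exact ⟨hVE₀ (.inl i) (.inl j), hVE₀ (.inr i) (.inl j)⟩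
  have hclosure : E₀ = E := by
    refine le_antisymm (Subfield.closure_le.2 ?_) fun x hx => ?_
    · rintro _ (⟨f, hf, rfl⟩ | ⟨i, j, rfl⟩)
      · exact (hστ f).trans (congrArg φ hf)
      · exact hj.apply_realForm W _ _
    · have : x ∈ hj.complexify E₀ := hWmem (htop ▸ IntermediateField.mem_top)
      rw [← hj.rePart_of_apply_eq ((hE x).1 hx)]
      exact this.1
  have hWmat : W.map d = A.map φ * W := Matrix.ext hW
  have hV : (realForm σ (φ I) W).map d = (realForm τ I A).map φ * realForm σ (φ I) W := by
    rw [map_realForm hd hdj, hWmat, hj.realForm_mul, realForm_map hστ]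
  exact ⟨{
    Et := T
    dE := d
    isPV := hPV
    σ := σ
    comm_deriv := hd
    invol := hσ
    restricts := hστ
    E := E
    fixed := rfl
    constants_real := fun x hx hdx => by
      obtain ⟨c, rfl⟩ := hconst x hdx
      have := (hE _).1 hx
      rw [hστ, hτC] at this
      obtain ⟨r, rfl⟩ := Complex.conj_eq_iff_real.1 (RatFunc.C_injective (φ.injective this))
      exact ⟨r, rfl⟩
    pv_real := by
      refine ⟨n + n, (realForm τ I A).submatrix e.symm e.symm, V,
        (realForm σ (φ I) W').submatrix e.symm e.symm, fun i j => hI.apply_realForm A _ _,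
        ?_, ?_, fun i j => hj.apply_realForm W _ _, fun i j => hj.apply_realForm W' _ _,
        fun i j => ?_, hclosure⟩
      · rw [Matrix.submatrix_mul_equiv, ← hj.realForm_mul, hWW', hj.realForm_one,
          Matrix.submatrix_one_equiv]
      · rw [Matrix.submatrix_mul_equiv, ← hj.realForm_mul, hW'W, hj.realForm_one,
          Matrix.submatrix_one_equiv]
      · change (realForm σ (φ I) W).map d (e.symm i) (e.symm j) =
          (((realForm τ I A).map φ).submatrix e.symm e.symm * V) i j
        rw [hV, Matrix.submatrix_mul_equiv, Matrix.submatrix_apply] }⟩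

section Differential

variable {F L : Type*} [Field F] [Field L] {n : ℕ} {dF : Der F} {dL : Der L} {φ : F →+* L}
  {A : Matrix (Fin n) (Fin n) F} {W W' : Matrix (Fin n) (Fin n) L}

theorem map_der_inverse (hWW' : W * W' = 1) (hW'W : W' * W = 1)
    (hW : W.map dL = A.map φ * W) : W'.map dL = -(W' * A.map φ) := by
  have h1 : (1 : Matrix (Fin n) (Fin n) L).map dL = 0 := by
    ext i j
    by_cases hij : i = j <;> simp [hij]
  have h : A.map φ + W * W'.map dL = 0 := by
    rw [← h1, ← hWW', Der.map_mul_matrix, hW, Matrix.mul_assoc, hWW', Matrix.mul_one]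
  calc W'.map dL = W' * (W * W'.map dL) := by rw [← Matrix.mul_assoc, hW'W, Matrix.one_mul]
    _ = _ := by rw [eq_neg_of_add_eq_zero_right h, Matrix.mul_neg]

/-- The subfield of `L` generated over `F` by the entries of `W`. -/
def generatedSubfield (φ : F →+* L) (W : Matrix (Fin n) (Fin n) L) : Subfield L :=
  Subfield.closure (Set.range φ ∪ {x | ∃ i j, W i j = x})

theorem map_mem_generatedSubfield (φ : F →+* L) (W : Matrix (Fin n) (Fin n) L) (f : F) :
    φ f ∈ generatedSubfield φ W :=
  Subfield.subset_closure (.inl ⟨f, rfl⟩)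

theorem apply_mem_generatedSubfield (φ : F →+* L) (W : Matrix (Fin n) (Fin n) L) (i j : Fin n) :
    W i j ∈ generatedSubfield φ W :=
  Subfield.subset_closure (.inr ⟨i, j, rfl⟩)

theorem Matrix.mul_apply_mem {R S : Type*} [CommRing R] [SetLike S R] [SubringClass S R] {s : S}
    {m : Type*} [Fintype m] {M N : Matrix m m R} (hM : ∀ i j, M i j ∈ s) (hN : ∀ i j, N i j ∈ s)
    (i j : m) : (M * N) i j ∈ s := by
  rw [Matrix.mul_apply]
  exact sum_mem fun k _ => mul_mem (hM i k) (hN k j)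

theorem inverse_apply_mem_generatedSubfield (φ : F →+* L) (hW'W : W' * W = 1) (i j : Fin n) :
    W' i j ∈ generatedSubfield φ W := by
  let M : Matrix (Fin n) (Fin n) (generatedSubfield φ W) :=
    fun i j => ⟨W i j, apply_mem_generatedSubfield φ W i j⟩
  have hM : M.map (generatedSubfield φ W).subtype = W := rfl
  have hdet : IsUnit M.det := by
    rw [isUnit_iff_ne_zero, ← map_ne_zero (generatedSubfield φ W).subtype, RingHom.map_det,
      RingHom.mapMatrix_apply, hM]
    intro h
    have := congrArg Matrix.det hW'W
    simp [h] at this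
  have hinv : M⁻¹.map (generatedSubfield φ W).subtype = W' := by
    have h : (M * M⁻¹).map (generatedSubfield φ W).subtype = 1 := by
      rw [Matrix.mul_nonsing_inv _ hdet]
      simp
    rw [Matrix.map_mul, hM] at h
    exact (left_inv_eq_right_inv hW'W h).symm
  rw [← hinv]
  exact (M⁻¹ i j).2

theorem der_mem_generatedSubfield (hφ : ∀ f, dL (φ f) = φ (dF f))
    (hW : W.map dL = A.map φ * W) {x : L} (hx : x ∈ generatedSubfield φ W) :
    dL x ∈ generatedSubfield φ W := by
  induction hx using Subfield.closure_induction with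
  | mem x hx =>
    rcases hx with ⟨f, rfl⟩ | ⟨i, j, rfl⟩
    · rw [hφ]
      exact map_mem_generatedSubfield φ W _
    · change (W.map dL) i j ∈ generatedSubfield φ W
      rw [hW]
      exact Matrix.mul_apply_mem (fun i j => map_mem_generatedSubfield φ W _)
        (apply_mem_generatedSubfield φ W) i j
  | one => rw [Derivation.map_one_eq_zero]; exact zero_mem _
  | add x y _ _ hx hy => rw [map_add]; exact add_mem hx hy
  | neg x _ hx => rw [map_neg]; exact neg_mem hx
  | inv x hx' hx =>
    rw [Derivation.leibniz_inv]
    exact mul_mem (neg_mem (pow_mem (inv_mem hx') 2)) hx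
  | mul x y hx' hy' hx hy =>
    rw [Derivation.leibniz]
    exact add_mem (mul_mem hx' hy) (mul_mem hy' hx)

/-- If the system `∂y = A y` is equivalent to its conjugate and the constants of `L` come from
`F`, then the field generated by a fundamental matrix is stable under the conjugation. -/
theorem apply_mem_generatedSubfield_of_equiv {τ : F ≃+* F} {s : L ≃+* L}
    (hφ : ∀ f, dL (φ f) = φ (dF f)) (hsφ : ∀ f, s (φ f) = φ (τ f))
    (hsd : ∀ x, s (dL x) = dL (s x)) (hconst : ∀ x, dL x = 0 → x ∈ φ.range)
    (hWW' : W * W' = 1) (hW'W : W' * W = 1) (hW : W.map dL = A.map φ * W)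
    {C C' : Matrix (Fin n) (Fin n) F} (hCC' : C * C' = 1) (hC'C : C' * C = 1)
    (hequiv : C' * A * C - C' * C.map dF = A.map τ) {x : L} (hx : x ∈ generatedSubfield φ W) :
    s x ∈ generatedSubfield φ W := by
  have hdC : C.map dF = A * C - C * A.map τ := by
    rw [← hequiv, Matrix.mul_sub, ← Matrix.mul_assoc, ← Matrix.mul_assoc, ← Matrix.mul_assoc, hCC',
      Matrix.one_mul, Matrix.one_mul, sub_sub_cancel]
  have hdCL : (C.map φ).map dL = A.map φ * C.map φ - C.map φ * (A.map τ).map φ := by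
    rw [← Matrix.map_mul, ← Matrix.map_mul, ← Matrix.map_sub _ (map_sub φ), ← hdC]
    ext i j
    simp [hφ]
  have hsW : (W.map s).map dL = (A.map τ).map φ * W.map s := by
    have : (A.map τ).map φ = (A.map φ).map s := by
      ext i j
      simp [hsφ]
    rw [this, ← Matrix.map_mul, ← hW]
    ext i j
    simp [hsd]
  let M := W' * (C.map φ * W.map s)
  have hM : M.map dL = 0 := by
    rw [Der.map_mul_matrix, Der.map_mul_matrix, map_der_inverse hWW' hW'W hW, hdCL, hsW]
    noncomm_ring
  have hsW' : W.map s = C'.map φ * (W * M) := by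
    rw [← Matrix.mul_assoc W, hWW', Matrix.one_mul, ← Matrix.mul_assoc, ← Matrix.map_mul, hC'C]
    simp
  refine (Subfield.closure_le (t := (generatedSubfield φ W).comap (s : L →+* L))).2 ?_ hx
  rintro _ (⟨f, rfl⟩ | ⟨i, j, rfl⟩)
  · change s (φ f) ∈ generatedSubfield φ W
    rw [hsφ]
    exact map_mem_generatedSubfield φ W _
  · change W.map s i j ∈ generatedSubfield φ W
    rw [hsW']
    refine Matrix.mul_apply_mem (fun i j => map_mem_generatedSubfield φ W _)
      (Matrix.mul_apply_mem (apply_mem_generatedSubfield φ W) fun i j => ?_) i j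
    obtain ⟨f, hf⟩ := hconst (M i j) (congrFun (congrFun hM i) j)
    rw [← hf]
    exact map_mem_generatedSubfield φ W f

end Differential

section Restriction

variable {L : Type*} [Field L] {S : Subfield L}

/-- The restriction of a derivation to a stable subfield. -/
def Der.restrict (d : Der L) (h : ∀ x ∈ S, d x ∈ S) : Der S :=
  derOfLeibniz
    { toFun x := ⟨d x, h x x.2⟩
      map_zero' := Subtype.ext (map_zero d)
      map_add' x y := Subtype.ext (map_add d (x : L) y) }
    fun x y => Subtype.ext (d.leibniz (x : L) y)

theorem Der.coe_restrict (d : Der L) (h : ∀ x ∈ S, d x ∈ S) (x : S) :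
    (d.restrict h x : L) = d x := rfl

/-- The restriction of an involution to a stable subfield. -/
def restrictInvolution (s : L ≃+* L) (hs : ∀ x, s (s x) = x) (h : ∀ x ∈ S, s x ∈ S) :
    S ≃+* S where
  toFun x := ⟨s x, h x x.2⟩
  invFun x := ⟨s x, h x x.2⟩
  left_inv x := Subtype.ext (hs x)
  right_inv x := Subtype.ext (hs x)
  map_mul' x y := Subtype.ext (map_mul s (x : L) y)
  map_add' x y := Subtype.ext (map_add s (x : L) y)

end Restriction

theorem isPicardVessiotExtension_generatedSubfield {K F L : Type*} [Field K] [Field F] [Algebra K F]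
    [Field L] {n : ℕ} {dF : Der F} {dL : Der L} {φ : F →+* L} {A : Matrix (Fin n) (Fin n) F}
    {W W' : Matrix (Fin n) (Fin n) L} (hφ : ∀ f, dL (φ f) = φ (dF f))
    (hWW' : W * W' = 1) (hW'W : W' * W = 1) (hW : W.map dL = A.map φ * W)
    (hconst : ∀ x, dL x = 0 ↔ ∃ c : K, x = φ (algebraMap K F c)) :
    letI : Algebra F (generatedSubfield φ W) :=
      (φ.codRestrict _ (map_mem_generatedSubfield φ W)).toAlgebra
    IsPicardVessiotExtension K F (generatedSubfield φ W) dF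
      (dL.restrict fun _ => der_mem_generatedSubfield hφ hW) A := by
  let : Algebra F (generatedSubfield φ W) :=
      (φ.codRestrict _ (map_mem_generatedSubfield φ W)).toAlgebra
  let U : Matrix (Fin n) (Fin n) (generatedSubfield φ W) :=
    fun i j => ⟨W i j, apply_mem_generatedSubfield φ W i j⟩
  let U' : Matrix (Fin n) (Fin n) (generatedSubfield φ W) :=
    fun i j => ⟨W' i j, inverse_apply_mem_generatedSubfield φ hW'W i j⟩
  have hinj : Function.Injective fun M : Matrix (Fin n) (Fin n) (generatedSubfield φ W) =>
      M.map (generatedSubfield φ W).subtype :=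
    Matrix.map_injective Subtype.val_injective
  refine ⟨fun f => Subtype.ext (hφ f), ⟨U, U', hinj ?_, hinj ?_, fun i j => Subtype.ext ?_, ?_⟩,
    fun x => ?_⟩
  · change (U * U').map (generatedSubfield φ W).subtype = Matrix.map 1 _
    rw [Matrix.map_mul, Matrix.map_one _ (map_zero _) (map_one _)]
    exact hWW'
  · change (U' * U).map (generatedSubfield φ W).subtype = Matrix.map 1 _
    rw [Matrix.map_mul, Matrix.map_one _ (map_zero _) (map_one _)]
    exact hW'W
  · change (W.map dL) i j = ((A.map (algebraMap F _) * U).map (generatedSubfield φ W).subtype) i j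
    rw [Matrix.map_mul, hW]
    rfl
  · refine eq_top_iff.2 fun x _ => ?_
    have hle : generatedSubfield φ W ≤
        (IntermediateField.adjoin F {x | ∃ i j, U i j = x}).toSubfield.map
          (generatedSubfield φ W).subtype := by
      refine Subfield.closure_le.2 ?_
      rintro _ (⟨f, rfl⟩ | ⟨i, j, rfl⟩)
      · exact ⟨algebraMap F _ f, IntermediateField.algebraMap_mem _ f, rfl⟩
      · exact ⟨U i j, IntermediateField.subset_adjoin _ _ ⟨i, j, rfl⟩, rfl⟩
    obtain ⟨y, hy, hyx⟩ := hle x.2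
    rwa [← Subtype.ext hyx]
  · rw [← Subtype.coe_inj, Der.coe_restrict, ZeroMemClass.coe_zero, hconst]
    simp only [← Subtype.coe_inj]
    rfl

namespace RatFunc

theorem der_laurentExpansion {K : Type*} [Field K] {d : Der (RatFunc K)} (hX : d X = 1)
    (hC : ∀ c, d (C c) = 0) (a : K) (f : RatFunc K) :
    LaurentSeries.der K (laurentExpansion a f) = laurentExpansion a (d f) := by
  have : d.eqLocus (LaurentSeries.der K) (laurentExpansion a) = ⊤ := by
    refine subfield_eq_top (fun c => ?_) ?_
    · change LaurentSeries.der K (laurentExpansion a (C c)) = laurentExpansion a (d (C c))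
      rw [hC, map_zero, laurentExpansion_C, ← HahnSeries.ofPowerSeries_C, LaurentSeries.der_coe]
      simp
    · change LaurentSeries.der K (laurentExpansion a X) = laurentExpansion a (d X)
      rw [hX, map_one, laurentExpansion_X, LaurentSeries.der_coe]
      simp
  exact (this ▸ Subfield.mem_top f : f ∈ d.eqLocus (LaurentSeries.der K) (laurentExpansion a))

theorem mapEquiv_laurentExpansion {K : Type*} [Field K] {τ : RatFunc K ≃+* RatFunc K} {e : K ≃+* K}
    (hτC : ∀ c, τ (C c) = C (e c)) (hτX : τ X = X) {a : K} (ha : e a = a) (f : RatFunc K) :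
    LaurentSeries.mapEquiv e (laurentExpansion a f) = laurentExpansion a (τ f) := by
  have hmapC : ∀ c, LaurentSeries.mapEquiv e (HahnSeries.C c) = HahnSeries.C (e c) :=
    fun c => HahnSeries.map_C c (e : K →+* K)
  refine RingHom.congr_fun (ringHom_ext (φ := (LaurentSeries.mapEquiv e : _ →+* _).comp
    (laurentExpansion a)) (ψ := (laurentExpansion a).comp (τ : _ →+* _)) (fun c => ?_) ?_) f
  · change LaurentSeries.mapEquiv e (laurentExpansion a (C c)) = laurentExpansion a (τ (C c))
    rw [hτC, laurentExpansion_C, laurentExpansion_C, hmapC]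
  · change LaurentSeries.mapEquiv e (laurentExpansion a X) = laurentExpansion a (τ X)
    rw [hτX, laurentExpansion_X, map_add, map_add, HahnSeries.ofPowerSeries_C, hmapC, ha,
      HahnSeries.ofPowerSeries_X]
    congr 1
    exact (HahnSeries.map_single (e : ZeroHom K K)).trans (by simp)

theorem exists_fundamental_matrix_laurentExpansion {K : Type*} [Field K] [CharZero K] {n : ℕ}
    {A : Matrix (Fin n) (Fin n) (RatFunc K)} {a : K} (ha : ∀ i j, (A i j).denom.eval a ≠ 0) :
    ∃ W W' : Matrix (Fin n) (Fin n) (LaurentSeries K), W * W' = 1 ∧ W' * W = 1 ∧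
      W.map (LaurentSeries.der K) = A.map (laurentExpansion a) * W := by
  choose B hB using fun i j => exists_laurentExpansion_eq_coe (ha i j)
  have hB' : A.map (laurentExpansion a) = (Matrix.of B).map (HahnSeries.ofPowerSeries ℤ K) :=
    Matrix.ext hB
  obtain ⟨W, W', h1, h2, h3⟩ := PowerSeries.exists_fundamental_matrix (Matrix.of B)
  refine ⟨W.map (HahnSeries.ofPowerSeries ℤ K), W'.map (HahnSeries.ofPowerSeries ℤ K), ?_, ?_, ?_⟩
  · rw [← Matrix.map_mul, h1, Matrix.map_one _ (map_zero _) (map_one _)]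
  · rw [← Matrix.map_mul, h2, Matrix.map_one _ (map_zero _) (map_one _)]
  · rw [hB', ← Matrix.map_mul, ← h3]
    exact Matrix.ext fun i j => LaurentSeries.der_coe (W i j)

end RatFunc

/-- Let `ℂ(z)` carry the derivation `d/dz` and let `τ` be the automorphism
conjugating all coefficients. If the equation `∂y = A y` is equivalent to its conjugate
`∂y = τ(A) y`, i.e. `C⁻¹ A C − C⁻¹ ∂C = τ(A)` for some `C ∈ GLₙ(ℂ(z))`, then there is a
Picard-Vessiot extension `Et` of `ℂ(z)` for `A` with an involutive differential automorphism
`σ` extending `τ`, whose fixed field is a Picard-Vessiot extension of `ℝ(z)`. -/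
theorem descend_to_real (dC : Der (RatFunc ℂ))
    (hX : dC RatFunc.X = 1) (hCc : ∀ c : ℂ, dC (RatFunc.C c) = 0)
    (τ : RatFunc ℂ ≃+* RatFunc ℂ)
    (hτC : ∀ c : ℂ, τ (RatFunc.C c) = RatFunc.C (starRingEnd ℂ c))
    (hτX : τ RatFunc.X = RatFunc.X)
    (hτd : ∀ f : RatFunc ℂ, τ (dC f) = dC (τ f))
    (n : ℕ) (A : Matrix (Fin n) (Fin n) (RatFunc ℂ))
    (C C' : Matrix (Fin n) (Fin n) (RatFunc ℂ)) (hCC' : C * C' = 1) (hC'C : C' * C = 1)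
    (hequiv : C' * A * C - C' * (C.map fun f => dC f) = A.map fun f => τ f) :
    Nonempty (DescendedPicardVessiotData dC τ A) := by
  have hττ : ∀ f, τ (τ f) = f := fun f =>
    RingHom.congr_fun (RatFunc.ringHom_ext (φ := (τ : RatFunc ℂ →+* RatFunc ℂ).comp τ)
      (ψ := RingHom.id _) (fun c => by simp [hτC]) (by simp [hτX])) f
  obtain ⟨r, hr⟩ := RatFunc.exists_real_forall_denom_eval_ne_zero fun p : Fin n × Fin n => A p.1 p.2
  obtain ⟨W, W', hWW', hW'W, hW⟩ :=
    RatFunc.exists_fundamental_matrix_laurentExpansion fun i j => hr (i, j)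
  set φ := RatFunc.laurentExpansion (r : ℂ)
  let conj : ℂ ≃+* ℂ := Complex.conjAe.toRingEquiv
  let s := LaurentSeries.mapEquiv conj
  have hs : ∀ x, s (s x) = x := fun x => by
    ext k
    exact Complex.conj_conj _
  have hsd : ∀ x, s (LaurentSeries.der ℂ x) = LaurentSeries.der ℂ (s x) :=
    LaurentSeries.mapEquiv_der conj
  have hφd := RatFunc.der_laurentExpansion hX hCc (r : ℂ)
  have hsφ : ∀ f, s (φ f) = φ (τ f) :=
    RatFunc.mapEquiv_laurentExpansion hτC hτX (Complex.conj_ofReal r)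
  have hconst : ∀ x, LaurentSeries.der ℂ x = 0 ↔ ∃ c : ℂ, x = φ (algebraMap ℂ _ c) := fun x => by
    simp only [RatFunc.algebraMap_eq_C]
    refine ⟨fun hx => ⟨x.coeff 0, ?_⟩, ?_⟩
    · rw [RatFunc.laurentExpansion_C]
      exact LaurentSeries.eq_C_of_der_eq_zero hx
    · rintro ⟨c, rfl⟩
      rw [hφd, hCc, map_zero]
  let : Algebra (RatFunc ℂ) (generatedSubfield φ W) :=
      (φ.codRestrict _ (map_mem_generatedSubfield φ W)).toAlgebra
  have hstable : ∀ x ∈ generatedSubfield φ W, s x ∈ generatedSubfield φ W := fun x =>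
    apply_mem_generatedSubfield_of_equiv hφd hsφ hsd
      (fun x hx => ((hconst x).1 hx).elim fun c hc => ⟨_, hc.symm⟩) hWW' hW'W hW hCC' hC'C hequiv
  exact (isPicardVessiotExtension_generatedSubfield hφd hWW' hW'W hW hconst).descend hτC hττ
    (restrictInvolution s hs hstable) (fun x => Subtype.ext (hsd x)) (fun x => Subtype.ext (hs x))
    fun f => Subtype.ext (hsφ f)
end
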